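/- arXiv:2006.13356 — 7 statements merged into one kernel-verified Lean document; each statement's English description precedes it below -/
import Mathlib

section
/- Let A be a set of natural numbers with natural density 1. Then for every integer k ≥ 2, the k-fold product set A^k = A···A (k times) has natural density 1. -/
open Filter Topology Pointwise
open scoped Classical

/-- The natural density of a set `A` of positive integers is `d` if
`#(A ∩ [1,N]) / N → d` as `N → ∞`. -/
def HasDensity (A : Set ℕ) (d : ℝ) : Prop :=
  Filter.Tendsto
    (fun N : ℕ => (((Finset.Icc 1 N).filter (fun n => n ∈ A)).card : ℝ) / N)
    Filter.atTop (nhds d)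

namespace ArithmeticFunction

open scoped ArithmeticFunction.zeta ArithmeticFunction.Moebius

/-- If `u` is bounded by `1` and has mean value `L`, and `∑ f m / m` converges absolutely, then the
Dirichlet convolution `f * u` has mean value `L * ∑ f m / m`. -/
theorem tendsto_mean_mul {f u : ArithmeticFunction ℝ} {L : ℝ}
    (hf : Summable fun m : ℕ => ‖f m / m‖) (hu : ∀ n, |u n| ≤ 1)
    (hL : Tendsto (fun N : ℕ => (∑ n ∈ Finset.Ioc 0 N, u n) / (N : ℝ)) atTop (𝓝 L)) :
    Tendsto (fun N : ℕ => (∑ n ∈ Finset.Ioc 0 N, (f * u) n) / (N : ℝ)) atTop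
      (𝓝 (∑' m : ℕ, f m / m * L)) := by
  set U : ℕ → ℝ := fun N => ∑ n ∈ Finset.Ioc 0 N, u n with hU
  have hUle : ∀ N, |U N| ≤ N := fun N => by
    calc |U N| ≤ ∑ n ∈ Finset.Ioc 0 N, |u n| := Finset.abs_sum_le_sum_abs _ _
      _ ≤ ∑ n ∈ Finset.Ioc 0 N, 1 := Finset.sum_le_sum fun n _ => hu n
      _ = N := by simp
  have hsum : ∀ N : ℕ, (∑ n ∈ Finset.Ioc 0 N, (f * u) n) / (N : ℝ) =
      ∑' m : ℕ, f m * U (N / m) / N := fun N => by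
    rw [sum_Ioc_mul_eq_sum_sum, Finset.sum_div]
    refine (tsum_eq_sum fun m hm => ?_).symm
    rcases Nat.eq_zero_or_pos m with rfl | hm0
    · simp
    · have : N < m := by
        by_contra! h
        exact hm (Finset.mem_Ioc.2 ⟨hm0, h⟩)
      simp [Nat.div_eq_of_lt this]
  simp_rw [hsum]
  refine tendsto_tsum_of_dominated_convergence hf (fun m => ?_)
    (Eventually.of_forall fun N m => ?_)
  · rcases Nat.eq_zero_or_pos m with rfl | hm
    · simp
    · have hm' : (m : ℝ) ≠ 0 := by positivity
      have h1 : Tendsto (fun N : ℕ => U (N / m) / ((N / m : ℕ) : ℝ)) atTop (𝓝 L) :=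
        hL.comp (Nat.tendsto_div_const_atTop hm.ne')
      have h2 : Tendsto (fun N : ℕ => ((N / m : ℕ) : ℝ) / N) atTop (𝓝 (1 / m)) := by
        have := (tendsto_nat_floor_mul_div_atTop (R := ℝ) (a := 1 / m) (by positivity)).comp
          tendsto_natCast_atTop_atTop
        refine this.congr fun N => ?_
        simp only [Function.comp_apply]
        rw [one_div_mul_eq_div, Nat.floor_div_eq_div]
      have h3 := (h1.mul h2).const_mul (f m)
      have h4 : f m * (L * (1 / m)) = f m / m * L := by ring
      rw [h4] at h3
      refine h3.congr' ?_
      filter_upwards [eventually_ge_atTop m] with N hN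
      have hq : ((N / m : ℕ) : ℝ) ≠ 0 := by
        exact_mod_cast (Nat.div_pos hN hm).ne'
      field_simp
  · rcases Nat.eq_zero_or_pos m with rfl | hm
    · simp
    rcases Nat.eq_zero_or_pos N with rfl | hN
    · simpa using div_nonneg (abs_nonneg (f m)) (Nat.cast_nonneg m)
    rw [mul_div_assoc, norm_mul, norm_div (f m), div_eq_mul_inv ‖f m‖]
    gcongr
    rw [norm_div, Real.norm_natCast, Real.norm_natCast, Real.norm_eq_abs, ← one_div,
      div_le_div_iff₀ (by positivity) (by positivity), one_mul]
    calc |U (N / m)| * m ≤ ((N / m : ℕ) : ℝ) * m := by gcongr; exact hUle _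
      _ ≤ N := by exact_mod_cast Nat.div_mul_le_self N m

/-- The arithmetic function `n ↦ n ^ (-δ)`. -/
noncomputable def rpowNeg (δ : ℝ) : ArithmeticFunction ℝ :=
  ⟨fun n => if n = 0 then 0 else (n : ℝ) ^ (-δ), by simp⟩

theorem rpowNeg_apply (δ : ℝ) (n : ℕ) :
    rpowNeg δ n = if n = 0 then 0 else (n : ℝ) ^ (-δ) := rfl

theorem rpowNeg_nonneg (δ : ℝ) (n : ℕ) : 0 ≤ rpowNeg δ n := by
  rw [rpowNeg_apply]
  split_ifs <;> positivity

theorem rpowNeg_le_one {δ : ℝ} (hδ : 0 ≤ δ) (n : ℕ) : rpowNeg δ n ≤ 1 := by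
  rw [rpowNeg_apply]
  split_ifs with h
  · exact zero_le_one
  · exact Real.rpow_le_one_of_one_le_of_nonpos (by exact_mod_cast Nat.one_le_iff_ne_zero.2 h)
      (by linarith)

theorem rpowNeg_mul (δ : ℝ) (m n : ℕ) : rpowNeg δ (m * n) = rpowNeg δ m * rpowNeg δ n := by
  simp only [rpowNeg_apply, mul_eq_zero]
  by_cases hm : m = 0
  · simp [hm]
  by_cases hn : n = 0
  · simp [hn]
  simp [hm, hn, Real.mul_rpow]

theorem isMultiplicative_rpowNeg (δ : ℝ) : (rpowNeg δ).IsMultiplicative :=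
  ⟨by simp [rpowNeg_apply], fun {m n} _ => rpowNeg_mul δ m n⟩

theorem rpowNeg_div_natCast {δ : ℝ} (n : ℕ) :
    rpowNeg δ n / n = if n = 0 then 0 else 1 / (n : ℝ) ^ (1 + δ) := by
  rw [rpowNeg_apply]
  split_ifs with h
  · simp
  · have : (0 : ℝ) < n := by exact_mod_cast Nat.pos_of_ne_zero h
    rw [Real.rpow_neg this.le, Real.rpow_add this, Real.rpow_one]
    field_simp

theorem summable_rpowNeg_div {δ : ℝ} (hδ : 0 < δ) :
    Summable fun n : ℕ => rpowNeg δ n / n := by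
  refine (Real.summable_one_div_nat_rpow.2 (by linarith : 1 < 1 + δ)).congr fun n => ?_
  rw [rpowNeg_div_natCast]
  split_ifs with h
  · simp [h, Real.zero_rpow (by linarith : 1 + δ ≠ 0)]
  · rfl

/-- The multiplicative function `n ↦ ∏ p ∣ n, (1 - p ^ (-δ))`. -/
noncomputable def rpowNegCofactor (δ : ℝ) : ArithmeticFunction ℝ :=
  pmul (μ : ArithmeticFunction ℝ) (rpowNeg δ) * (ζ : ArithmeticFunction ℝ)

theorem rpowNeg_mul_rpowNegCofactor (δ : ℝ) :
    rpowNeg δ * rpowNegCofactor δ = (ζ : ArithmeticFunction ℝ) := by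
  have h : rpowNeg δ * pmul (μ : ArithmeticFunction ℝ) (rpowNeg δ) = 1 := by
    ext n
    have h1 : (1 : ArithmeticFunction ℝ) n = (1 : ArithmeticFunction ℝ) n * rpowNeg δ n := by
      rcases eq_or_ne n 1 with rfl | hn
      · simp [rpowNeg_apply]
      · simp [one_apply_ne hn]
    rw [h1, ← coe_zeta_mul_coe_moebius (R := ℝ), mul_apply, mul_apply, Finset.sum_mul]
    refine Finset.sum_congr rfl fun x hx => ?_
    obtain ⟨h1, h2⟩ := Nat.mem_divisorsAntidiagonal.1 hx
    have hx1 : x.1 ≠ 0 := by rintro h; simp [h] at h1; exact h2 h1.symm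
    rw [← h1, rpowNeg_mul, pmul_apply, natCoe_apply, zeta_apply_ne hx1]
    push_cast
    ring
  rw [rpowNegCofactor, ← mul_assoc, h, one_mul]

theorem rpowNegCofactor_nonneg {δ : ℝ} (hδ : 0 ≤ δ) (n : ℕ) : 0 ≤ rpowNegCofactor δ n := by
  rcases eq_or_ne n 0 with rfl | hn
  · simp
  have hmul : (rpowNegCofactor δ).IsMultiplicative :=
    (isMultiplicative_moebius.intCast.pmul (isMultiplicative_rpowNeg δ)).mul
      isMultiplicative_zeta.natCast
  rw [hmul.multiplicative_factorization _ hn]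
  refine Finset.prod_nonneg fun p hp => ?_
  have hp' : p.Prime := Nat.prime_of_mem_primeFactors hp
  have hk : n.factorization p ≠ 0 := Finsupp.mem_support_iff.1 hp
  obtain ⟨k, hk⟩ := Nat.exists_eq_succ_of_ne_zero hk
  simp only [hk]
  rw [rpowNegCofactor, coe_mul_zeta_apply, Nat.sum_divisors_prime_pow hp',
    Finset.sum_range_succ', Finset.sum_eq_single 0]
  · simp [moebius_apply_prime hp', rpowNeg_le_one hδ, isMultiplicative_rpowNeg δ |>.map_one]
  · intro i _ hi
    simp [moebius_apply_prime_pow hp', hi]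
  · simp

theorem rpowNegCofactor_le_one {δ : ℝ} (hδ : 0 ≤ δ) (n : ℕ) : rpowNegCofactor δ n ≤ 1 := by
  rcases eq_or_ne n 0 with rfl | hn
  · simp
  have h := congrArg (· n) (rpowNeg_mul_rpowNegCofactor δ)
  simp only [mul_apply, natCoe_apply, zeta_apply_ne hn, Nat.cast_one] at h
  rw [← h]
  have := Finset.single_le_sum (s := n.divisorsAntidiagonal)
    (f := fun x => rpowNeg δ x.1 * rpowNegCofactor δ x.2)
    (fun x _ => mul_nonneg (rpowNeg_nonneg _ _) (rpowNegCofactor_nonneg hδ _))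
    (show (1, n) ∈ n.divisorsAntidiagonal from
      Nat.mem_divisorsAntidiagonal.2 ⟨one_mul n, hn⟩)
  simpa [(isMultiplicative_rpowNeg δ).map_one] using this

theorem tendsto_mean_zeta :
    Tendsto (fun N : ℕ => (∑ n ∈ Finset.Ioc 0 N, (ζ : ArithmeticFunction ℝ) n) / (N : ℝ)) atTop
      (𝓝 1) := by
  refine tendsto_const_nhds.congr' ?_
  filter_upwards [eventually_gt_atTop 0] with N hN
  rw [Finset.sum_congr rfl (g := fun _ => (1 : ℝ))]
  · simp [hN.ne']
  · intro n hn
    simp [(Finset.mem_Ioc.1 hn).1.ne']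

theorem tendsto_mean_rpowNegCofactor {δ : ℝ} (hδ : 0 < δ) :
    Tendsto (fun N : ℕ => (∑ n ∈ Finset.Ioc 0 N, rpowNegCofactor δ n) / (N : ℝ)) atTop
      (𝓝 (∑' n : ℕ, rpowNeg δ n / n)⁻¹) := by
  have hg : Summable fun n : ℕ => ‖rpowNeg δ n / n‖ := (summable_rpowNeg_div hδ).norm
  have hlim := tendsto_mean_mul (f := pmul (μ : ArithmeticFunction ℝ) (rpowNeg δ))
    (hg.of_nonneg_of_le (fun _ => norm_nonneg _) fun n => ?_) (fun n => ?_) tendsto_mean_zeta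
  · rw [← rpowNegCofactor] at hlim
    have h1 := tendsto_mean_mul hg (fun n => abs_le.2
      ⟨by linarith [rpowNegCofactor_nonneg hδ.le n], rpowNegCofactor_le_one hδ.le n⟩) hlim
    rw [rpowNeg_mul_rpowNegCofactor, tsum_mul_right] at h1
    rwa [eq_inv_of_mul_eq_one_right (tendsto_nhds_unique h1 tendsto_mean_zeta)] at hlim
  · rw [pmul_apply, mul_div_assoc, norm_mul]
    refine mul_le_of_le_one_left (norm_nonneg _) ?_
    rw [intCoe_apply, Real.norm_eq_abs]
    exact_mod_cast abs_moebius_le_one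
  · by_cases hn : n = 0 <;> simp [hn]

/-- The indicator of the positive integers outside `A`. -/
noncomputable def complIndicator (A : Set ℕ) : ArithmeticFunction ℝ :=
  ⟨fun n => if n = 0 ∨ n ∈ A then 0 else 1, by simp⟩

theorem complIndicator_apply (A : Set ℕ) (n : ℕ) :
    complIndicator A n = if n = 0 ∨ n ∈ A then 0 else 1 := rfl

theorem complIndicator_nonneg (A : Set ℕ) (n : ℕ) : 0 ≤ complIndicator A n := by
  rw [complIndicator_apply]
  split_ifs <;> norm_num

theorem complIndicator_le_one (A : Set ℕ) (n : ℕ) : complIndicator A n ≤ 1 := by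
  rw [complIndicator_apply]
  split_ifs <;> norm_num

theorem hasDensity_one_iff (A : Set ℕ) :
    HasDensity A 1 ↔
      Tendsto (fun N : ℕ => (∑ n ∈ Finset.Ioc 0 N, complIndicator A n) / (N : ℝ)) atTop (𝓝 0) := by
  have key : ∀ N : ℕ, 0 < N →
      (((Finset.Icc 1 N).filter (fun n => n ∈ A)).card : ℝ) / N =
        1 - (∑ n ∈ Finset.Ioc 0 N, complIndicator A n) / (N : ℝ) := fun N hN => by
    have h1 : (((Finset.Icc 1 N).filter (fun n => n ∈ A)).card : ℝ) +
        ∑ n ∈ Finset.Ioc 0 N, complIndicator A n = N := by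
      rw [Finset.card_filter, Nat.cast_sum, show Finset.Icc 1 N = Finset.Ioc 0 N from rfl,
        ← Finset.sum_add_distrib, Finset.sum_congr rfl (g := fun _ => (1 : ℝ))]
      · simp
      · intro n hn
        have := (Finset.mem_Ioc.1 hn).1.ne'
        by_cases h : n ∈ A <;> simp [complIndicator_apply, h, this]
    have : (N : ℝ) ≠ 0 := by positivity
    field_simp
    linarith
  unfold HasDensity
  constructor <;> intro h
  · have := h.const_sub 1
    rw [sub_self] at this
    refine this.congr' ?_
    filter_upwards [eventually_gt_atTop 0] with N hN
    rw [key N hN]; ring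
  · have := h.const_sub 1
    rw [sub_zero] at this
    refine this.congr' ?_
    filter_upwards [eventually_gt_atTop 0] with N hN
    rw [key N hN]

theorem complIndicator_mul_le (A B : Set ℕ) {δ : ℝ} (hδ : 0 ≤ δ) (n : ℕ) :
    complIndicator (A * B) n ≤
      (pmul (complIndicator A) (rpowNeg δ) * rpowNegCofactor δ) n +
        (rpowNeg δ * complIndicator B) n := by
  have hnn := fun x : ℕ × ℕ =>
    mul_nonneg (rpowNeg_nonneg δ x.1) (rpowNegCofactor_nonneg hδ x.2)
  rw [mul_apply, mul_apply, ← Finset.sum_add_distrib, complIndicator_apply]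
  split_ifs with h
  · refine Finset.sum_nonneg fun x _ => ?_
    have h1 := mul_nonneg (complIndicator_nonneg A x.1) (hnn x)
    have h2 := mul_nonneg (rpowNeg_nonneg δ x.1) (complIndicator_nonneg B x.2)
    rw [pmul_apply]
    linarith
  · rw [not_or] at h
    have h1 := congrArg (· n) (rpowNeg_mul_rpowNegCofactor δ)
    simp only [mul_apply, natCoe_apply, zeta_apply_ne h.1, Nat.cast_one] at h1
    rw [← h1]
    refine Finset.sum_le_sum fun x hx => ?_
    obtain ⟨hx1, hx2⟩ := Nat.mem_divisorsAntidiagonal.1 hx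
    have hne : x.1 ≠ 0 ∧ x.2 ≠ 0 := by
      rw [← mul_ne_zero_iff, hx1]; exact hx2
    rw [pmul_apply]
    by_cases hA : x.1 ∈ A
    · have hB : x.2 ∉ B := fun hB => h.2 (hx1 ▸ Set.mul_mem_mul hA hB)
      have := mul_le_mul_of_nonneg_left (rpowNegCofactor_le_one hδ x.2) (rpowNeg_nonneg δ x.1)
      simpa [complIndicator_apply, hA, hB, hne] using this
    · have := mul_nonneg (rpowNeg_nonneg δ x.1) (complIndicator_nonneg B x.2)
      rw [complIndicator_apply A, if_neg (by simp [hA, hne])]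
      linarith

theorem tendsto_one_add_nhdsGT_zero :
    Tendsto (fun δ : ℝ => 1 + δ) (𝓝[>] 0) (𝓝[>] 1) := by
  refine tendsto_nhdsWithin_iff.2 ⟨?_, ?_⟩
  · have : Tendsto (fun δ : ℝ => 1 + δ) (𝓝 0) (𝓝 (1 + 0)) :=
      (continuous_const.add continuous_id).tendsto 0
    rw [add_zero] at this
    exact this.mono_left nhdsWithin_le_nhds
  · filter_upwards [self_mem_nhdsWithin] with δ hδ
    simpa using hδ

/-- A set of density zero has logarithmic density zero, in the form of a limit of Dirichlet
series. -/
theorem tendsto_mul_tsum_complIndicator {A : Set ℕ} (hA : HasDensity A 1) :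
    Tendsto (fun δ : ℝ => δ * ∑' n : ℕ, complIndicator A n * (rpowNeg δ n / n)) (𝓝[>] 0)
      (𝓝 0) := by
  have h := LSeries_tendsto_sub_mul_nhds_one_of_tendsto_sum_div_and_nonneg (complIndicator A)
    ((hasDensity_one_iff A).1 hA) (complIndicator_nonneg A)
  rw [← tendsto_ofReal_iff]
  refine (h.comp tendsto_one_add_nhdsGT_zero).congr fun δ => ?_
  have hterm : ∀ n : ℕ, LSeries.term (fun n => (complIndicator A n : ℂ)) ((1 + δ : ℝ) : ℂ) n =
      ((complIndicator A n * (rpowNeg δ n / n) : ℝ) : ℂ) := fun n => by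
    rw [LSeries.term_def, rpowNeg_div_natCast]
    split_ifs with hn
    · simp
    · rw [Complex.ofReal_mul, Complex.ofReal_div, Complex.ofReal_cpow (Nat.cast_nonneg n)]
      simp [div_eq_mul_inv]
  simp only [Function.comp_apply, LSeries, hterm]
  rw [← Complex.ofReal_tsum]
  push_cast
  ring

theorem tendsto_mul_tsum_rpowNeg_div :
    Tendsto (fun δ : ℝ => δ * ∑' n : ℕ, rpowNeg δ n / n) (𝓝[>] 0) (𝓝 1) := by
  refine (tendsto_sub_mul_tsum_nat_rpow.comp tendsto_one_add_nhdsGT_zero).congr' ?_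
  filter_upwards [self_mem_nhdsWithin] with δ hδ
  have hδ' : (1 + δ) ≠ 0 := by have : 0 < δ := hδ; linarith
  simp only [Function.comp_apply, add_sub_cancel_left]
  congr 1
  refine tsum_congr fun n => ?_
  rw [rpowNeg_div_natCast]
  split_ifs with hn
  · simp [hn, Real.zero_rpow hδ']
  · rfl

theorem hasDensity_one_mul {A B : Set ℕ} (hA : HasDensity A 1) (hB : HasDensity B 1) :
    HasDensity (A * B) 1 := by
  rw [hasDensity_one_iff]
  have hratio : Tendsto (fun δ : ℝ => (∑' n : ℕ, complIndicator A n * (rpowNeg δ n / n)) *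
      (∑' n : ℕ, rpowNeg δ n / n)⁻¹) (𝓝[>] 0) (𝓝 0) := by
    have := (tendsto_mul_tsum_complIndicator hA).div tendsto_mul_tsum_rpowNeg_div one_ne_zero
    rw [zero_div] at this
    refine this.congr' ?_
    filter_upwards [self_mem_nhdsWithin] with δ hδ
    have hδ' : δ ≠ 0 := ne_of_gt hδ
    simp only [Pi.div_apply]
    rw [mul_div_mul_left _ _ hδ', div_eq_mul_inv]
  have hnn : ∀ N : ℕ, 0 ≤ (∑ n ∈ Finset.Ioc 0 N, complIndicator (A * B) n) / (N : ℝ) := fun N =>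
    div_nonneg (Finset.sum_nonneg fun n _ => complIndicator_nonneg _ n) (Nat.cast_nonneg N)
  refine tendsto_order.2 ⟨fun a ha => Eventually.of_forall fun N => ha.trans_le (hnn N),
    fun ε hε => ?_⟩
  obtain ⟨δ, hδε, hδ⟩ := ((hratio.eventually (gt_mem_nhds hε)).and self_mem_nhdsWithin).exists
  replace hδ : 0 < δ := hδ
  have hg := (summable_rpowNeg_div hδ).norm
  have h1 := tendsto_mean_mul (f := pmul (complIndicator A) (rpowNeg δ))
    (hg.of_nonneg_of_le (fun _ => norm_nonneg _) fun n => by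
      rw [pmul_apply, mul_div_assoc, norm_mul]
      refine mul_le_of_le_one_left (norm_nonneg _) ?_
      rw [Real.norm_of_nonneg (complIndicator_nonneg A n)]
      exact complIndicator_le_one A n)
    (fun n => abs_le.2 ⟨by linarith [rpowNegCofactor_nonneg hδ.le n],
      rpowNegCofactor_le_one hδ.le n⟩) (tendsto_mean_rpowNegCofactor hδ)
  have h2 := tendsto_mean_mul hg (fun n => abs_le.2
    ⟨by linarith [complIndicator_nonneg B n], complIndicator_le_one B n⟩)
    ((hasDensity_one_iff B).1 hB)
  have h3 := h1.add h2
  simp only [mul_zero, tsum_zero, add_zero, tsum_mul_right, pmul_apply, mul_div_assoc] at h3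
  filter_upwards [h3.eventually (gt_mem_nhds hδε)] with N hN
  refine lt_of_le_of_lt ?_ hN
  rw [← add_div, ← Finset.sum_add_distrib]
  gcongr with n _
  exact complIndicator_mul_le A B hδ.le n

end ArithmeticFunction

theorem kfold_product_of_density_one_set_has_density_one
    (A : Set ℕ) (hA : HasDensity A 1) (k : ℕ) (hk : 2 ≤ k) :
    HasDensity (A ^ k) 1 := by
  have h : ∀ j : ℕ, HasDensity (A ^ (j + 1)) 1 := fun j => by
    induction j with
    | zero => simpa using hA
    | succ j ih =>
      rw [pow_succ]
      exact ArithmeticFunction.hasDensity_one_mul ih hA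
  obtain ⟨j, rfl⟩ := Nat.exists_eq_add_of_le' (one_le_two.trans hk)
  exact h j
end

section
/- For every real α with 0 ≤ α < 1 and every ε > 0, there exists a set A of positive integers whose natural density exists and equals α, and such that the natural density of the product set A·A exists and is less than ε. In other words, the infimum of d(A·A) over all sets A of natural density α is 0 for every α ∈ [0,1). -/
open Filter Topology Pointwise
open scoped Classical

/-- The averages of `f` over `[1, N]` tend to `m` as `N → ∞`. -/
def HasMean (f : ℕ → ℝ) (m : ℝ) : Prop :=
  Tendsto (fun N : ℕ => (∑ n ∈ Finset.Icc 1 N, f n) / N) atTop (𝓝 m)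

lemma hasDensity_iff_hasMean {A : Set ℕ} {d : ℝ} :
    HasDensity A d ↔ HasMean (fun n => if n ∈ A then 1 else 0) d := by
  simp [HasDensity, HasMean]

lemma HasMean.add {f g : ℕ → ℝ} {a b : ℝ} (hf : HasMean f a) (hg : HasMean g b) :
    HasMean (fun n => f n + g n) (a + b) := by
  simpa [HasMean, Finset.sum_add_distrib, add_div] using Tendsto.add hf hg

lemma HasMean.const_mul {f : ℕ → ℝ} {a : ℝ} (c : ℝ) (hf : HasMean f a) :
    HasMean (fun n => c * f n) (c * a) := by
  simpa [HasMean, ← Finset.mul_sum, mul_div_assoc] using Tendsto.const_mul c hf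

lemma HasMean.sum {ι : Type*} {s : Finset ι} {f : ι → ℕ → ℝ} {a : ι → ℝ}
    (h : ∀ i ∈ s, HasMean (f i) (a i)) : HasMean (fun n => ∑ i ∈ s, f i n) (∑ i ∈ s, a i) := by
  have := tendsto_finsetSum s h
  refine this.congr fun N => ?_
  rw [Finset.sum_comm, Finset.sum_div]

lemma hasMean_const (c : ℝ) : HasMean (fun _ => c) c := by
  refine (tendsto_const_nhds (x := c)).congr' ?_
  filter_upwards [eventually_gt_atTop 0] with N hN
  have : (N : ℝ) ≠ 0 := by positivity
  simp [this]

lemma HasMean.mono {f g : ℕ → ℝ} {a b : ℝ} (hf : HasMean f a) (hg : HasMean g b)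
    (h : ∀ n, 0 < n → f n ≤ g n) : a ≤ b := by
  refine le_of_tendsto_of_tendsto' hf hg fun N => ?_
  gcongr with n hn
  exact h n (Finset.mem_Icc.1 hn).1

lemma hasMean_modEq {q : ℕ} (hq : 0 < q) (r : ℕ) :
    HasMean (fun n => if n ≡ r [MOD q] then 1 else 0) (1 / q) := by
  have hbound : ∀ N : ℕ,
      |(((Finset.Ioc 0 N).filter (· ≡ r [MOD q])).card : ℚ) - N / q| ≤ 1 := by
    intro N
    have h := Nat.Ioc_filter_modEq_card 0 N hq r
    set x : ℚ := ((N : ℕ) - r) / q with hx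
    set y : ℚ := ((0 : ℕ) - r) / q with hy
    have h' : (((Finset.Ioc 0 N).filter (· ≡ r [MOD q])).card : ℚ) = max ((⌊x⌋ : ℚ) - ⌊y⌋) 0 := by
      exact_mod_cast h
    have hxy : (N : ℚ) / q = x - y := by
      rw [hx, hy]
      push_cast
      ring
    have h0 : (0 : ℚ) ≤ N / q := by positivity
    rw [h', abs_le]
    have := Int.floor_le x
    have := Int.lt_floor_add_one x
    have := Int.floor_le y
    have := Int.lt_floor_add_one y
    constructor
    · linarith [le_max_left ((⌊x⌋ : ℚ) - ⌊y⌋) 0]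
    · rw [sub_le_iff_le_add, max_le_iff]
      constructor <;> linarith
  rw [HasMean, tendsto_iff_dist_tendsto_zero]
  refine squeeze_zero' (Eventually.of_forall fun _ => dist_nonneg) ?_
    (tendsto_one_div_atTop_nhds_zero_nat (𝕜 := ℝ))
  filter_upwards [eventually_gt_atTop 0] with N hN
  have hN' : (0 : ℝ) < N := by exact_mod_cast hN
  have h : |(((Finset.Ioc 0 N).filter (· ≡ r [MOD q])).card : ℝ) - N / q| ≤ 1 := by
    have := (Rat.cast_le (K := ℝ)).2 (hbound N)
    push_cast at this
    exact this
  rw [Finset.sum_boole, Real.dist_eq, le_div_iff₀ hN', ← abs_of_pos hN', ← abs_mul, abs_of_pos hN',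
    sub_mul, div_mul_cancel₀ _ hN'.ne', one_div_mul_eq_div]
  exact h

lemma HasMean.of_periodic {f : ℕ → ℝ} {q : ℕ} (hq : 0 < q) (hf : Function.Periodic f q) :
    HasMean f (∑ r ∈ Finset.range q, f r * (1 / q)) := by
  have := HasMean.sum (s := Finset.range q) fun r _ => (hasMean_modEq hq r).const_mul (f r)
  convert this using 2 with n
  have h : ∀ r ∈ Finset.range q, (f r * if n ≡ r [MOD q] then 1 else 0) =
      if r = n % q then f r else 0 := by
    intro r hr
    have : n ≡ r [MOD q] ↔ r = n % q := by
      rw [Nat.ModEq, Nat.mod_eq_of_lt (Finset.mem_range.1 hr), eq_comm]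
    simp [this]
  rw [Finset.sum_congr rfl h, Finset.sum_ite_eq' (Finset.range q), if_pos (by simp [Nat.mod_lt _ hq]),
    hf.map_mod_nat]

lemma hasMean_dvd {d : ℕ} (hd : 0 < d) : HasMean (fun n => if d ∣ n then 1 else 0) (1 / d) := by
  simpa [Nat.modEq_zero_iff_dvd] using hasMean_modEq hd 0

/-- The positive integers divisible by some element of `D`. -/
def multiples (D : Finset ℕ) : Set ℕ := {n | 0 < n ∧ ∃ d ∈ D, d ∣ n}

/-- The odd integers divisible by some element of `D`. -/
def oddMultiples (D : Finset ℕ) : Set ℕ := {n | Odd n ∧ ∃ d ∈ D, d ∣ n}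

/-- The integers `2 ^ s * x` with `s ∈ S` and `x ∈ X`. -/
def twoDilates (S X : Set ℕ) : Set ℕ := {n | ∃ s ∈ S, ∃ x ∈ X, 2 ^ s * x = n}

lemma mem_twoDilates {S X : Set ℕ} {n : ℕ} :
    n ∈ twoDilates S X ↔ ∃ s ∈ S, ∃ x ∈ X, 2 ^ s * x = n := Iff.rfl

lemma exists_hasDensity_oddMultiples {D : Finset ℕ} (hD : 0 ∉ D) :
    ∃ c, HasDensity (oddMultiples D) c := by
  have hq : 0 < 2 * ∏ d ∈ D, d :=
    Nat.mul_pos two_pos <| Finset.prod_pos fun d hd =>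
      Nat.pos_of_ne_zero fun h => hD (h ▸ hd)
  refine ⟨_, hasDensity_iff_hasMean.2 (HasMean.of_periodic hq fun n => ?_)⟩
  have h : n + 2 * ∏ d ∈ D, d ∈ oddMultiples D ↔ n ∈ oddMultiples D := by
    refine and_congr (by simp [Nat.odd_add]) ?_
    refine exists_congr fun d => and_congr_right fun hd => ?_
    exact (Nat.dvd_add_left ((Finset.dvd_prod_of_mem (fun d => d) hd).mul_left 2))
  simp [h]

lemma oddMultiples_mul (D E : Finset ℕ) :
    oddMultiples D * oddMultiples E = oddMultiples (D * E) := by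
  ext n
  simp only [Set.mem_mul, oddMultiples, Set.mem_ofPred_eq, Finset.mem_mul]
  constructor
  · rintro ⟨a, ⟨ha, d, hd, hda⟩, b, ⟨hb, e, he, heb⟩, rfl⟩
    exact ⟨ha.mul hb, d * e, ⟨d, hd, e, he, rfl⟩, mul_dvd_mul hda heb⟩
  · rintro ⟨hn, _, ⟨d, hd, e, he, rfl⟩, k, rfl⟩
    rw [mul_assoc, Nat.odd_mul] at hn
    exact ⟨d, ⟨hn.1, d, hd, dvd_rfl⟩, e * k, ⟨hn.2, e, he, dvd_mul_right _ _⟩, by ring⟩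

lemma twoDilates_mul (S T X Y : Set ℕ) :
    twoDilates S X * twoDilates T Y = twoDilates (S + T) (X * Y) := by
  ext n
  simp only [Set.mem_mul, Set.mem_add, twoDilates, Set.mem_ofPred_eq]
  constructor
  · rintro ⟨_, ⟨s, hs, x, hx, rfl⟩, _, ⟨t, ht, y, hy, rfl⟩, rfl⟩
    exact ⟨s + t, ⟨s, hs, t, ht, rfl⟩, x * y, ⟨x, hx, y, hy, rfl⟩, by ring⟩
  · rintro ⟨_, ⟨s, hs, t, ht, rfl⟩, _, ⟨x, hx, y, hy, rfl⟩, rfl⟩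
    exact ⟨_, ⟨s, hs, x, hx, rfl⟩, _, ⟨t, ht, y, hy, rfl⟩, by ring⟩

lemma twoDilates_oddMultiples_subset (S : Set ℕ) (D : Finset ℕ) :
    twoDilates S (oddMultiples D) ⊆ multiples D := by
  rintro _ ⟨s, -, x, ⟨hx, d, hd, hdx⟩, rfl⟩
  exact ⟨Nat.mul_pos (by positivity) hx.pos, d, hd, hdx.mul_left _⟩

lemma twoDilates_univ_oddMultiples {D : Finset ℕ} (hD : ∀ d ∈ D, Odd d) :
    twoDilates Set.univ (oddMultiples D) = multiples D := by
  refine (twoDilates_oddMultiples_subset _ _).antisymm ?_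
  rintro n ⟨hn, d, hd, hdn⟩
  obtain ⟨s, x, hx, rfl⟩ := Nat.exists_eq_two_pow_mul_odd hn.ne'
  exact ⟨s, trivial, x, ⟨hx, d, hd,
    ((Nat.coprime_two_right.2 (hD d hd)).pow_right s).dvd_of_dvd_mul_left hdn⟩, rfl⟩

lemma card_filter_twoDilates (S : Set ℕ) {X : Set ℕ} (hX : ∀ x ∈ X, Odd x) (N : ℕ) :
    ((Finset.Icc 1 N).filter (· ∈ twoDilates S X)).card =
      ∑ s ∈ Finset.range (N + 1),
        if s ∈ S then ((Finset.Icc 1 (N / 2 ^ s)).filter (· ∈ X)).card else 0 := by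
  have h : (Finset.Icc 1 N).filter (· ∈ twoDilates S X) =
      ((Finset.range (N + 1)).filter (· ∈ S)).biUnion fun s =>
        ((Finset.Icc 1 (N / 2 ^ s)).filter (· ∈ X)).image (2 ^ s * ·) := by
    ext n
    simp only [Finset.mem_filter, Finset.mem_Icc, Finset.mem_biUnion, Finset.mem_range,
      Finset.mem_image, mem_twoDilates]
    constructor
    · rintro ⟨⟨h1, hN⟩, s, hs, x, hx, rfl⟩
      have hx0 : 1 ≤ x := (hX x hx).pos
      refine ⟨s, ⟨?_, hs⟩, x, ⟨⟨hx0, ?_⟩, hx⟩, rfl⟩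
      · have := Nat.lt_two_pow_self (n := s)
        nlinarith
      · rwa [Nat.le_div_iff_mul_le (by positivity), mul_comm]
    · rintro ⟨s, ⟨-, hs⟩, x, ⟨⟨h1, hN⟩, hx⟩, rfl⟩
      rw [Nat.le_div_iff_mul_le (by positivity), mul_comm] at hN
      exact ⟨⟨Nat.mul_pos (by positivity) h1, hN⟩, s, hs, x, hx, rfl⟩
  rw [h, Finset.card_biUnion, Finset.sum_filter]
  · refine Finset.sum_congr rfl fun s _ => ?_
    rw [Finset.card_image_of_injective _ (mul_right_injective₀ (by positivity))]
  · intro s _ t _ hst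
    rw [Function.onFun, Finset.disjoint_left]
    simp only [Finset.mem_image, Finset.mem_filter]
    rintro _ ⟨x, ⟨-, hx⟩, rfl⟩ ⟨y, ⟨-, hy⟩, hxy⟩
    refine hst ?_
    have hv : ∀ s x, x ∈ X → padicValNat 2 (2 ^ s * x) = s := by
      intro s x hx
      have hodd := hX x hx
      rw [padicValNat.mul (by positivity) hodd.pos.ne', padicValNat.prime_pow,
        padicValNat.eq_zero_of_not_dvd hodd.not_two_dvd_nat, add_zero]
    rw [← hv s x hx, ← hv t y hy, hxy]

lemma tendsto_natCast_div_div (q : ℕ) :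
    Tendsto (fun N : ℕ => ((N / q : ℕ) : ℝ) / N) atTop (𝓝 (1 / q)) := by
  have := (tendsto_nat_floor_mul_div_atTop (R := ℝ) (a := 1 / q) (by positivity)).comp
    tendsto_natCast_atTop_atTop
  refine this.congr fun N => ?_
  simp only [Function.comp_apply]
  rw [one_div_mul_eq_div, Nat.floor_div_natCast, Nat.floor_natCast]

lemma HasDensity.twoDilates {X : Set ℕ} {c : ℝ} (hc : HasDensity X c) (hX : ∀ x ∈ X, Odd x)
    (S : Set ℕ) :
    HasDensity (twoDilates S X) (∑' s : ℕ, if s ∈ S then c * (1 / 2) ^ s else 0) := by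
  set F : ℕ → ℕ := fun M => ((Finset.Icc 1 M).filter (· ∈ X)).card with hF
  have hFle : ∀ M, F M ≤ M := fun M => (Finset.card_filter_le _ _).trans (by simp)
  have key : Tendsto (fun N : ℕ => ∑' s : ℕ, if s ∈ S then (F (N / 2 ^ s) : ℝ) / N else 0) atTop
      (𝓝 (∑' s : ℕ, if s ∈ S then c * (1 / 2) ^ s else 0)) := by
    refine tendsto_tsum_of_dominated_convergence (bound := fun s => (1 / 2 : ℝ) ^ s)
      (summable_geometric_of_lt_one (by norm_num) (by norm_num)) (fun s => ?_)
      (Eventually.of_forall fun N s => ?_)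
    · split_ifs
      · have h1 : Tendsto (fun N : ℕ => (F (N / 2 ^ s) : ℝ) / (N / 2 ^ s : ℕ)) atTop (𝓝 c) :=
          Tendsto.comp hc (Nat.tendsto_div_const_atTop (by positivity))
        have h2 := h1.mul (tendsto_natCast_div_div (2 ^ s))
        have h3 : c * (1 / ((2 ^ s : ℕ) : ℝ)) = c * (1 / 2) ^ s := by
          push_cast; rw [one_div_pow]
        rw [h3] at h2
        refine h2.congr fun N => ?_
        rcases Nat.eq_zero_or_pos (N / 2 ^ s) with h | h
        · simp [h, hF]
        · have : ((N / 2 ^ s : ℕ) : ℝ) ≠ 0 := by positivity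
          field_simp
      · exact tendsto_const_nhds
    · split_ifs
      · rw [Real.norm_of_nonneg (by positivity)]
        refine div_le_of_le_mul₀ (by positivity) (by positivity) ?_
        calc (F (N / 2 ^ s) : ℝ) ≤ (N / 2 ^ s : ℕ) := by exact_mod_cast hFle _
          _ ≤ N / (2 ^ s : ℕ) := Nat.cast_div_le
          _ = (1 / 2) ^ s * N := by push_cast; rw [one_div_pow]; ring
      · simp
  refine key.congr fun N => ?_
  rw [card_filter_twoDilates S hX N, tsum_eq_sum (s := Finset.range (N + 1))]
  · push_cast
    rw [Finset.sum_div]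
    refine Finset.sum_congr rfl fun s _ => ?_
    split_ifs <;> simp [hF]
  · intro s hs
    have : N / 2 ^ s = 0 := Nat.div_eq_of_lt <| by
      have := Nat.lt_two_pow_self (n := s)
      simp at hs
      omega
    simp [this, hF]

lemma exists_tsum_ite_one_half_pow {x : ℝ} (hx : x ∈ Set.Ico (0 : ℝ) 1) :
    ∃ S : Set ℕ, ∑' s : ℕ, (if s ∈ S then (1 / 2 : ℝ) ^ s else 0) = 2 * x := by
  refine ⟨{s | Real.digits x 2 s = 1}, ?_⟩
  conv_rhs => rw [← Real.ofDigits_digits one_lt_two hx]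
  rw [Real.ofDigits, ← tsum_mul_left]
  refine tsum_congr fun s => ?_
  rw [Real.ofDigitsTerm]
  simp only [Set.mem_ofPred_eq]
  rcases Fin.exists_fin_two.1 ⟨Real.digits x 2 s, rfl⟩ with h | h <;> simp [h, pow_succ]

/-- The Turán variance inequality for the number of divisors of `n` in a finite set of primes. -/
lemma exists_hasMean_variance {P : Finset ℕ} (hP : ∀ p ∈ P, p.Prime) :
    ∃ v ≤ ∑ p ∈ P, 1 / (p : ℝ), HasMean
      (fun n => ((P.filter (· ∣ n)).card - ∑ p ∈ P, 1 / (p : ℝ)) ^ 2) v := by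
  set M := ∑ p ∈ P, 1 / (p : ℝ) with hM
  have h1 : HasMean (fun n => ∑ p ∈ P, if p ∣ n then (1 : ℝ) else 0) M :=
    HasMean.sum fun p hp => hasMean_dvd (hP p hp).pos
  have h2 : HasMean (fun n => ∑ p ∈ P, ∑ q ∈ P, if p.lcm q ∣ n then (1 : ℝ) else 0)
      (∑ p ∈ P, ∑ q ∈ P, 1 / (p.lcm q : ℝ)) :=
    HasMean.sum fun p hp => HasMean.sum fun q hq =>
      hasMean_dvd (Nat.lcm_pos (hP p hp).pos (hP q hq).pos)
  refine ⟨(∑ p ∈ P, ∑ q ∈ P, 1 / (p.lcm q : ℝ)) + -2 * M * M + M ^ 2, ?_, ?_⟩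
  rotate_left
  · convert (h2.add (h1.const_mul (-2 * M))).add (hasMean_const (M ^ 2)) using 2 with n
    have h3 : ∀ p q, (if p.lcm q ∣ n then (1 : ℝ) else 0) =
        (if p ∣ n then 1 else 0) * (if q ∣ n then 1 else 0) := by
      intro p q
      have := Nat.lcm_dvd_iff (m := p) (n := q) (k := n)
      split_ifs <;> simp_all
    simp only [h3, ← Finset.sum_mul_sum]
    rw [Finset.card_filter]
    push_cast
    ring
  · have h4 : ∀ p ∈ P, ∀ q ∈ P, 1 / (p.lcm q : ℝ) ≤
        1 / (p : ℝ) * (1 / (q : ℝ)) + if p = q then 1 / (p : ℝ) else 0 := by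
      intro p hp q hq
      split_ifs with h
      · subst h
        rw [Nat.lcm_self]
        have : (0 : ℝ) ≤ 1 / (p : ℝ) * (1 / (p : ℝ)) := by positivity
        linarith
      · rw [Nat.Coprime.lcm_eq_mul ((Nat.coprime_primes (hP p hp) (hP q hq)).2 h)]
        simp [mul_comm]
    have h5 := Finset.sum_le_sum fun p hp => Finset.sum_le_sum (h4 p hp)
    simp only [Finset.sum_add_distrib, ← Finset.sum_mul_sum, Finset.sum_ite_eq] at h5
    rw [Finset.sum_congr rfl fun p hp => if_pos hp] at h5
    rw [← hM] at h5
    linarith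

lemma mem_multiples_pow_of_le_card {P : Finset ℕ} (hP : ∀ p ∈ P, p.Prime) {k n : ℕ} (hn : 0 < n)
    (h : k ≤ (P.filter (· ∣ n)).card) : n ∈ multiples (P ^ k) := by
  obtain ⟨T, hT, rfl⟩ := Finset.exists_subset_card_eq h
  refine ⟨hn, ∏ p ∈ T, p, ?_, ?_⟩
  · rw [← Finset.mem_coe, Finset.coe_pow, ← Finset.prod_const]
    exact Set.finsetProd_mem_finsetProd T _ _ fun p hp => (Finset.mem_filter.1 (hT hp)).1
  · exact Finset.prod_primes_dvd n (fun p hp => (hP p (Finset.mem_filter.1 (hT hp)).1).prime)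
      fun p hp => (Finset.mem_filter.1 (hT hp)).2

lemma exists_sq_dvd_or_le_card {P : Finset ℕ} {k d : ℕ} (hd : d ∈ P ^ k) :
    (∃ p ∈ P, p ^ 2 ∣ d) ∨ k ≤ (P.filter (· ∣ d)).card := by
  induction k generalizing d with
  | zero => simp
  | succ k ih =>
    rw [pow_succ, Finset.mem_mul] at hd
    obtain ⟨e, he, p, hp, rfl⟩ := hd
    rcases ih he with ⟨q, hq, hqe⟩ | hk
    · exact .inl ⟨q, hq, hqe.mul_right p⟩
    by_cases hpe : p ∣ e
    · exact .inl ⟨p, hp, by rw [sq]; exact mul_dvd_mul_right hpe p⟩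
    · right
      have hlt : P.filter (· ∣ e) ⊂ P.filter (· ∣ e * p) := by
        rw [Finset.ssubset_iff_of_subset
          (Finset.monotone_filter_right _ fun q _ hq => Dvd.dvd.mul_right hq p)]
        exact ⟨p, by simp [hp], by simp [hpe]⟩
      have := Finset.card_lt_card hlt
      omega

lemma density_multiples_pow_ge {P : Finset ℕ} (hP : ∀ p ∈ P, p.Prime) {k : ℕ} {d : ℝ}
    (hM : 0 < ∑ p ∈ P, 1 / (p : ℝ)) (hk : k < 3 / 4 * ∑ p ∈ P, 1 / (p : ℝ) + 1)
    (hd : HasDensity (multiples (P ^ k)) d) : 1 - 16 / ∑ p ∈ P, 1 / (p : ℝ) ≤ d := by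
  obtain ⟨v, hv, hmean⟩ := exists_hasMean_variance hP
  set M := ∑ p ∈ P, 1 / (p : ℝ)
  have h := HasMean.mono (hasMean_const 1)
    ((hasDensity_iff_hasMean.1 hd).add (hmean.const_mul (16 / M ^ 2))) fun n hn => by
      split_ifs with hmem
      · have : 0 ≤ 16 / M ^ 2 * ((P.filter (· ∣ n)).card - M) ^ 2 := by positivity
        linarith
      · have hlt : (P.filter (· ∣ n)).card + 1 ≤ k := by
          by_contra! hle
          exact hmem (mem_multiples_pow_of_le_card hP hn (by omega))
        have hlt' : ((P.filter (· ∣ n)).card : ℝ) + 1 ≤ k := by exact_mod_cast hlt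
        rw [zero_add, div_mul_eq_mul_div, le_div_iff₀ (by positivity)]
        nlinarith
  have : 16 / M ^ 2 * v ≤ 16 / M := by
    calc 16 / M ^ 2 * v ≤ 16 / M ^ 2 * M := by gcongr
      _ = 16 / M := by field_simp
  linarith

lemma density_le_of_subset_multiples_pow {P : Finset ℕ} (hP : ∀ p ∈ P, p.Prime) {k : ℕ} {d : ℝ}
    {B : Set ℕ} (hB : B ⊆ multiples (P ^ k))
    (hM : 0 < ∑ p ∈ P, 1 / (p : ℝ)) (hk : 3 / 2 * ∑ p ∈ P, 1 / (p : ℝ) ≤ k)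
    (hd : HasDensity B d) :
    d ≤ 4 / ∑ p ∈ P, 1 / (p : ℝ) + ∑ p ∈ P, 1 / (p : ℝ) ^ 2 := by
  obtain ⟨v, hv, hmean⟩ := exists_hasMean_variance hP
  set M := ∑ p ∈ P, 1 / (p : ℝ)
  have hsq : HasMean (fun n => ∑ p ∈ P, if p ^ 2 ∣ n then (1 : ℝ) else 0)
      (∑ p ∈ P, 1 / ((p ^ 2 : ℕ) : ℝ)) :=
    HasMean.sum fun p hp => hasMean_dvd (pow_pos (hP p hp).pos 2)
  have h := HasMean.mono (hasDensity_iff_hasMean.1 hd)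
    ((hmean.const_mul (4 / M ^ 2)).add hsq) fun n hn => by
      have h0 : ∀ p ∈ P, (0 : ℝ) ≤ if p ^ 2 ∣ n then 1 else 0 := fun p _ => by
        split_ifs <;> norm_num
      have h1 : 0 ≤ 4 / M ^ 2 * ((P.filter (· ∣ n)).card - M) ^ 2 := by positivity
      have h2 := Finset.sum_nonneg h0
      split_ifs with hmem
      · obtain ⟨-, e, he, hen⟩ := hB hmem
        rcases exists_sq_dvd_or_le_card he with ⟨p, hp, hpe⟩ | hle
        · have := Finset.single_le_sum h0 hp
          rw [if_pos (hpe.trans hen)] at this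
          linarith
        · have hle' : k ≤ (P.filter (· ∣ n)).card := hle.trans <| Finset.card_le_card <|
            Finset.monotone_filter_right _ fun q _ hq => Dvd.dvd.trans hq hen
          have hle'' : (k : ℝ) ≤ (P.filter (· ∣ n)).card := by exact_mod_cast hle'
          have : 1 ≤ 4 / M ^ 2 * ((P.filter (· ∣ n)).card - M) ^ 2 := by
            rw [div_mul_eq_mul_div, le_div_iff₀ (by positivity)]
            nlinarith
          linarith
      · linarith
  have : 4 / M ^ 2 * v ≤ 4 / M := by
    calc 4 / M ^ 2 * v ≤ 4 / M ^ 2 * M := by gcongr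
      _ = 4 / M := by field_simp
  push_cast at h
  linarith

lemma exists_odd_primes_sum_one_div (C : ℝ) {δ : ℝ} (hδ : 0 < δ) :
    ∃ P : Finset ℕ, (∀ p ∈ P, p.Prime ∧ Odd p) ∧ C < ∑ p ∈ P, 1 / (p : ℝ) ∧
      ∑ p ∈ P, 1 / (p : ℝ) ^ 2 < δ := by
  obtain ⟨s, hs⟩ := summable_iff_vanishing_norm.1
    (Real.summable_one_div_nat_pow.2 one_lt_two) δ hδ
  have hnot : ¬ Summable (Set.indicator {p : ℕ | p.Prime} fun n => 1 / (n : ℝ)) :=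
    not_summable_one_div_on_primes
  set f := Set.indicator {p : ℕ | p.Prime} fun n => 1 / (n : ℝ) with hf
  have hf0 : ∀ n, 0 ≤ f n := fun n => Set.indicator_nonneg (fun _ _ => by positivity) n
  obtain ⟨u, hu⟩ : ∃ u : Finset ℕ, C + ∑ p ∈ insert 2 s, f p < ∑ p ∈ u, f p := by
    by_contra! h
    exact hnot (summable_of_sum_le hf0 h)
  refine ⟨(u \ insert 2 s).filter Nat.Prime, fun p hp => ?_, ?_, ?_⟩
  · simp only [Finset.mem_filter, Finset.mem_sdiff, Finset.mem_insert, not_or] at hp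
    exact ⟨hp.2, hp.2.odd_of_ne_two hp.1.2.1⟩
  · have h1 : ∑ p ∈ (u \ insert 2 s).filter Nat.Prime, 1 / (p : ℝ) =
        ∑ p ∈ u \ insert 2 s, f p := by
      rw [Finset.sum_filter]
      simp [hf, Set.indicator_apply]
    have h2 : ∑ p ∈ u, f p ≤ ∑ p ∈ u \ insert 2 s ∪ insert 2 s, f p :=
      Finset.sum_le_sum_of_subset_of_nonneg
        (by rw [Finset.sdiff_union_self_eq_union]; exact Finset.subset_union_left) fun p _ _ => hf0 p
    rw [Finset.sum_union Finset.sdiff_disjoint] at h2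
    linarith
  · refine (Real.le_norm_self _).trans_lt (hs _ ?_)
    rw [Finset.disjoint_left]
    intro p hp
    simp only [Finset.mem_filter, Finset.mem_sdiff, Finset.mem_insert, not_or] at hp
    exact hp.1.2.2

lemma odd_of_mem_pow {P : Finset ℕ} (hP : ∀ p ∈ P, Odd p) {k d : ℕ} (hd : d ∈ P ^ k) : Odd d := by
  induction k generalizing d with
  | zero => simp_all
  | succ k ih =>
    rw [pow_succ, Finset.mem_mul] at hd
    obtain ⟨e, he, p, hp, rfl⟩ := hd
    exact (ih he).mul (hP p hp)

theorem inf_density_of_square_is_zero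
    (α : ℝ) (hα0 : 0 ≤ α) (hα1 : α < 1) (ε : ℝ) (hε : 0 < ε) :
    ∃ A : Set ℕ, (∀ n ∈ A, 0 < n) ∧ HasDensity A α ∧
      ∃ d : ℝ, HasDensity (A * A) d ∧ d < ε := by
  obtain ⟨P, hP, hPM, hPsq⟩ :=
    exists_odd_primes_sum_one_div (max (16 / (1 - α)) (8 / ε)) (half_pos hε)
  obtain ⟨hPα, hPε⟩ := max_lt_iff.1 hPM
  have hprime : ∀ p ∈ P, p.Prime := fun p hp => (hP p hp).1
  have hodd : ∀ k, ∀ d ∈ P ^ k, Odd d := fun k d hd => odd_of_mem_pow (fun p hp => (hP p hp).2) hd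
  have hzero : ∀ k, 0 ∉ P ^ k := fun k h => by simpa using hodd k 0 h
  set M := ∑ p ∈ P, 1 / (p : ℝ) with hM
  have hM0 : 0 < M := lt_trans (by positivity) hPε
  set K := ⌈3 / 4 * M⌉₊ with hK
  obtain ⟨c, hc⟩ := exists_hasDensity_oddMultiples (hzero K)
  have hsum : ∀ S : Set ℕ, ∑' s : ℕ, (if s ∈ S then c * (1 / 2) ^ s else 0) =
      c * ∑' s : ℕ, (if s ∈ S then (1 / 2 : ℝ) ^ s else 0) := fun S => by
    rw [← tsum_mul_left]
    simp only [mul_ite, mul_zero]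
  have hE := hc.twoDilates (fun x hx => hx.1) Set.univ
  rw [twoDilates_univ_oddMultiples (hodd K), hsum] at hE
  simp only [Set.mem_univ, if_true, tsum_geometric_two] at hE
  have hge := density_multiples_pow_ge hprime hM0 (Nat.ceil_lt_add_one (by positivity)) hE
  have hlt : α < c * 2 := by
    have : 16 / M < 1 - α := by
      rw [div_lt_comm₀ hM0 (by linarith)]
      exact hPα
    linarith
  obtain ⟨S, hS⟩ := exists_tsum_ite_one_half_pow (x := α / (c * 2))
    ⟨div_nonneg hα0 (by linarith), (div_lt_one (by linarith)).2 hlt⟩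
  refine ⟨twoDilates S (oddMultiples (P ^ K)),
    fun n hn => (twoDilates_oddMultiples_subset _ _ hn).1, ?_, ?_⟩
  · have hA := hc.twoDilates (fun x hx => hx.1) S
    rw [hsum, hS] at hA
    have hc0 : c ≠ 0 := by rintro rfl; linarith
    convert hA using 1
    field_simp
  · obtain ⟨c', hc'⟩ := exists_hasDensity_oddMultiples (hzero (K + K))
    have hAA := hc'.twoDilates (fun x hx => hx.1) (S + S)
    refine ⟨_, by rwa [twoDilates_mul, oddMultiples_mul, ← pow_add], ?_⟩
    have hle := density_le_of_subset_multiples_pow hprime (twoDilates_oddMultiples_subset _ _) hM0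
      (by have := Nat.le_ceil (3 / 4 * M); push_cast; linarith) hAA
    have : 4 / M < ε / 2 := by
      rw [div_lt_iff₀ hM0]
      rw [div_lt_iff₀ hε] at hPε
      linarith
    linarith
end

section
/- For every ε with 0 < ε < 1, there exists a set A of positive integers whose natural density exists and is greater than 1 − ε, and such that the natural density of the product set A·A exists and is less than ε. -/
open Filter Topology Pointwise
open scoped Classical

/-- The number of prime factors of `n` lying in `P`, counted with multiplicity. -/
noncomputable def bigOmegaOn (P : Finset ℕ) (n : ℕ) : ℕ := ∑ p ∈ P, n.factorization p

/-- The number of elements of `P` dividing `n`, as a real number. -/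
noncomputable def omegaOn (P : Finset ℕ) (n : ℕ) : ℝ := ∑ p ∈ P, if p ∣ n then 1 else 0

/-- The positive integers with at least `k` prime factors in `P`, counted with multiplicity. -/
def manyFactors (P : Finset ℕ) (k : ℕ) : Set ℕ := {n | 0 < n ∧ k ≤ bigOmegaOn P n}

theorem hasDensity_of_periodic {A : Set ℕ} {M : ℕ} (hM : 0 < M)
    (h : ∀ n, 0 < n → (n + M ∈ A ↔ n ∈ A)) :
    HasDensity A (((Finset.Icc 1 M).filter (fun n => n ∈ A)).card / M) := by
  set a : ℕ → ℕ := fun N => ((Finset.Icc 1 N).filter (fun n => n ∈ A)).card with ha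
  have hstep (N : ℕ) : a (N + 1) = a N + if N + 1 ∈ A then 1 else 0 := by
    simp only [ha]
    rw [← Finset.insert_Icc_right_eq_Icc_add_one (by omega), Finset.filter_insert]
    split_ifs <;> simp
  have hadd (N : ℕ) : a (N + M) = a N + a M := by
    induction N with
    | zero => simp [ha]
    | succ N ih =>
      rw [show N + 1 + M = N + M + 1 by ring, hstep, hstep, ih,
        show N + M + 1 = N + 1 + M by ring]
      simp only [h (N + 1) (by omega)]
      ring
  have hM' : (M : ℝ) ≠ 0 := by positivity
  set c : ℝ := (a M : ℝ) / M with hc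
  have hper : Function.Periodic (fun N : ℕ => (a N : ℝ) - N * c) M := by
    intro N
    simp only [hadd, hc]
    push_cast
    field_simp
    ring
  have hbdd : ∃ B : ℝ, ∀ N : ℕ, |(a N : ℝ) - N * c| ≤ B := by
    refine ⟨∑ r ∈ Finset.range M, |(a r : ℝ) - r * c|, fun N => ?_⟩
    rw [← hper.map_mod_nat N]
    exact Finset.single_le_sum (f := fun r : ℕ => |(a r : ℝ) - r * c|)
      (fun _ _ => abs_nonneg _) (Finset.mem_range.2 (Nat.mod_lt _ hM))
  obtain ⟨B, hB⟩ := hbdd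
  have hlim : Tendsto (fun N : ℕ => ((a N : ℝ) - N * c) / N) atTop (𝓝 0) := by
    refine squeeze_zero_norm (fun N => ?_) (tendsto_const_div_atTop_nhds_zero_nat B)
    rw [Real.norm_eq_abs, abs_div, Nat.abs_cast]
    gcongr
    exact hB N
  have := hlim.add_const c
  rw [zero_add] at this
  refine this.congr' ?_
  filter_upwards [eventually_gt_atTop 0] with N hN
  have : (N : ℝ) ≠ 0 := by positivity
  simp only [ha]
  field_simp
  ring

section Primes

variable {P : Finset ℕ}

theorem bigOmegaOn_mul {a b : ℕ} (ha : a ≠ 0) (hb : b ≠ 0) :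
    bigOmegaOn P (a * b) = bigOmegaOn P a + bigOmegaOn P b := by
  simp [bigOmegaOn, Nat.factorization_mul ha hb, Finset.sum_add_distrib]

theorem bigOmegaOn_prime {p : ℕ} (hp : p.Prime) (hpP : p ∈ P) : bigOmegaOn P p = 1 := by
  simp [bigOmegaOn, hp.factorization, Finsupp.single_apply, hpP]

theorem le_sum_min_iff (P : Finset ℕ) (f : ℕ → ℕ) (k : ℕ) :
    k ≤ ∑ p ∈ P, min (f p) k ↔ k ≤ ∑ p ∈ P, f p := by
  refine ⟨fun h => h.trans (Finset.sum_le_sum fun _ _ => min_le_left _ _), fun h => ?_⟩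
  by_cases hf : ∃ p ∈ P, k ≤ f p
  · obtain ⟨p, hp, hk⟩ := hf
    refine le_trans ?_ (Finset.single_le_sum (f := fun p => min (f p) k) (by simp) hp)
    simp [hk]
  · push Not at hf
    rwa [Finset.sum_congr rfl fun p hp => min_eq_left (hf p hp).le]

theorem factorization_prod_primes (hP : ∀ p ∈ P, p.Prime) {p : ℕ} (hp : p ∈ P) :
    (∏ q ∈ P, q).factorization p = 1 := by
  rw [Nat.factorization_prod fun q hq => (hP q hq).ne_zero, Finset.sum_apply',
    Finset.sum_eq_single p]
  · exact (hP p hp).factorization_self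
  · intro q hq hqp
    simp [(hP q hq).factorization, hqp]
  · exact fun h => absurd hp h

theorem le_bigOmegaOn_gcd_iff (hP : ∀ p ∈ P, p.Prime) {n : ℕ} (hn : 0 < n) (k : ℕ) :
    k ≤ bigOmegaOn P (n.gcd ((∏ p ∈ P, p) ^ k)) ↔ k ≤ bigOmegaOn P n := by
  have hQ : (∏ p ∈ P, p) ^ k ≠ 0 :=
    pow_ne_zero _ (Finset.prod_ne_zero_iff.2 fun q hq => (hP q hq).ne_zero)
  rw [bigOmegaOn, bigOmegaOn, ← le_sum_min_iff P n.factorization k,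
    Nat.factorization_gcd hn.ne' hQ]
  have : ∑ p ∈ P, (n.factorization ⊓ ((∏ p ∈ P, p) ^ k).factorization) p
      = ∑ p ∈ P, min (n.factorization p) k := by
    refine Finset.sum_congr rfl fun p hp => ?_
    rw [Finsupp.inf_apply, Nat.factorization_pow, Finsupp.smul_apply,
      factorization_prod_primes hP hp, smul_eq_mul, mul_one]
  rw [this]

theorem hasDensity_manyFactors (hP : ∀ p ∈ P, p.Prime) (k : ℕ) :
    HasDensity (manyFactors P k)
      (((Finset.Icc 1 ((∏ p ∈ P, p) ^ k)).filter (fun n => n ∈ manyFactors P k)).card /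
        ((∏ p ∈ P, p) ^ k : ℕ)) := by
  refine hasDensity_of_periodic (pow_pos (Finset.prod_pos fun q hq => (hP q hq).pos) k) ?_
  intro n hn
  simp only [manyFactors, Set.mem_ofPred_eq, hn, Nat.add_pos_left hn, true_and]
  rw [← le_bigOmegaOn_gcd_iff hP hn, ← le_bigOmegaOn_gcd_iff hP (Nat.add_pos_left hn _),
    Nat.gcd_add_self_left]

theorem exists_dvd_bigOmegaOn_eq (hP : ∀ p ∈ P, p.Prime) {n : ℕ} (hn : 0 < n) {k : ℕ}
    (hk : k ≤ bigOmegaOn P n) : ∃ a, a ∣ n ∧ bigOmegaOn P a = k := by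
  induction k with
  | zero => exact ⟨1, one_dvd n, by simp [bigOmegaOn]⟩
  | succ k ih =>
    obtain ⟨a, ⟨b, rfl⟩, ha⟩ := ih (by omega)
    have ha0 : a ≠ 0 := by rintro rfl; simp at hn
    have hb0 : b ≠ 0 := by rintro rfl; simp at hn
    rw [bigOmegaOn_mul ha0 hb0, ha] at hk
    have hb : bigOmegaOn P b ≠ 0 := by omega
    obtain ⟨p, hp, hpb⟩ := Finset.exists_ne_zero_of_sum_ne_zero hb
    refine ⟨a * p, mul_dvd_mul_left a (Nat.dvd_of_factorization_pos hpb), ?_⟩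
    rw [bigOmegaOn_mul ha0 (hP p hp).ne_zero, ha, bigOmegaOn_prime (hP p hp) hp]

theorem manyFactors_mul_self (hP : ∀ p ∈ P, p.Prime) (k : ℕ) :
    manyFactors P k * manyFactors P k = manyFactors P (2 * k) := by
  ext n
  constructor
  · rintro ⟨a, ⟨ha0, ha⟩, b, ⟨hb0, hb⟩, rfl⟩
    refine ⟨Nat.mul_pos ha0 hb0, ?_⟩
    change 2 * k ≤ bigOmegaOn P (a * b)
    rw [bigOmegaOn_mul ha0.ne' hb0.ne']
    omega
  · rintro ⟨hn, hk⟩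
    obtain ⟨a, ⟨b, rfl⟩, ha⟩ := exists_dvd_bigOmegaOn_eq hP hn (show k ≤ bigOmegaOn P n by omega)
    have ha0 : 0 < a := Nat.pos_of_mul_pos_right hn
    have hb0 : 0 < b := Nat.pos_of_mul_pos_left hn
    rw [bigOmegaOn_mul ha0.ne' hb0.ne'] at hk
    exact ⟨a, ⟨ha0, ha.ge⟩, b, ⟨hb0, by omega⟩, rfl⟩

theorem sum_Icc_ite_dvd {N d : ℕ} (hd : d ∣ N) :
    ∑ n ∈ Finset.Icc 1 N, (if d ∣ n then (1 : ℝ) else 0) = N / d := by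
  rw [Finset.sum_boole, ← Nat.cast_div_charZero hd, ← Nat.Ioc_filter_dvd_card_eq_div]
  rfl

theorem sum_omegaOn {N : ℕ} (hN : ∏ p ∈ P, p ∣ N) :
    ∑ n ∈ Finset.Icc 1 N, omegaOn P n = N * ∑ p ∈ P, (1 / p : ℝ) := by
  simp only [omegaOn]
  rw [Finset.sum_comm, Finset.mul_sum]
  refine Finset.sum_congr rfl fun p hp => ?_
  rw [sum_Icc_ite_dvd ((Finset.dvd_prod_of_mem _ hp).trans hN), mul_one_div]

theorem sum_omegaOn_sq_le (hP : ∀ p ∈ P, p.Prime) {N : ℕ} (hN : ∏ p ∈ P, p ∣ N) :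
    ∑ n ∈ Finset.Icc 1 N, omegaOn P n ^ 2
      ≤ N * (∑ p ∈ P, (1 / p : ℝ)) ^ 2 + N * ∑ p ∈ P, (1 / p : ℝ) := by
  have hpN : ∀ p ∈ P, p ∣ N := fun p hp => (Finset.dvd_prod_of_mem _ hp).trans hN
  have key : ∀ p ∈ P, ∀ q ∈ P,
      ∑ n ∈ Finset.Icc 1 N, ((if p ∣ n then (1 : ℝ) else 0) * if q ∣ n then 1 else 0)
        ≤ N * ((1 / p) * (1 / q)) + if p = q then (N * (1 / p) : ℝ) else 0 := by
    intro p hp q hq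
    by_cases hpq : p = q
    · subst hpq
      have : ∀ n : ℕ, ((if p ∣ n then (1 : ℝ) else 0) * if p ∣ n then 1 else 0)
          = if p ∣ n then 1 else 0 := by intro n; split_ifs <;> simp
      simp only [this, sum_Icc_ite_dvd (hpN p hp), if_true, mul_one_div]
      have : (0 : ℝ) ≤ N * (1 / p * (1 / p)) := by positivity
      rw [mul_one_div] at this
      linarith
    · have hcop : p.Coprime q := (Nat.coprime_primes (hP p hp) (hP q hq)).2 hpq
      have : ∀ n : ℕ, ((if p ∣ n then (1 : ℝ) else 0) * if q ∣ n then 1 else 0)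
          = if p * q ∣ n then 1 else 0 := by
        intro n
        have hdvd : p * q ∣ n ↔ p ∣ n ∧ q ∣ n :=
          ⟨fun h => ⟨dvd_of_mul_right_dvd h, dvd_of_mul_left_dvd h⟩,
            fun h => hcop.mul_dvd_of_dvd_of_dvd h.1 h.2⟩
        by_cases h1 : p ∣ n <;> by_cases h2 : q ∣ n <;> simp [hdvd, h1, h2]
      simp only [this, hpq, if_false, add_zero]
      rw [sum_Icc_ite_dvd (hcop.mul_dvd_of_dvd_of_dvd (hpN p hp) (hpN q hq))]
      push_cast
      apply le_of_eq
      ring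
  calc ∑ n ∈ Finset.Icc 1 N, omegaOn P n ^ 2
      = ∑ p ∈ P, ∑ q ∈ P, ∑ n ∈ Finset.Icc 1 N,
          ((if p ∣ n then (1 : ℝ) else 0) * if q ∣ n then 1 else 0) := by
        simp only [omegaOn, sq, Finset.sum_mul_sum]
        rw [Finset.sum_comm]
        exact Finset.sum_congr rfl fun p _ => Finset.sum_comm
    _ ≤ ∑ p ∈ P, ∑ q ∈ P, (N * ((1 / p) * (1 / q)) + if p = q then (N * (1 / p) : ℝ) else 0) :=
        Finset.sum_le_sum fun p hp => Finset.sum_le_sum fun q hq => key p hp q hq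
    _ = _ := by
        simp only [Finset.sum_add_distrib, Finset.sum_ite_eq, ← Finset.mul_sum, sq,
          Finset.sum_mul_sum]
        congr 1
        rw [Finset.mul_sum]
        exact Finset.sum_congr rfl fun p hp => if_pos hp

/-- The Turán variance bound over a full period. -/
theorem sum_omegaOn_sub_sq_le (hP : ∀ p ∈ P, p.Prime) {N : ℕ} (hN : ∏ p ∈ P, p ∣ N) :
    ∑ n ∈ Finset.Icc 1 N, (omegaOn P n - ∑ p ∈ P, (1 / p : ℝ)) ^ 2
      ≤ N * ∑ p ∈ P, (1 / p : ℝ) := by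
  have h2 := sum_omegaOn_sq_le hP hN
  have h1 := sum_omegaOn hN
  set S := ∑ p ∈ P, (1 / p : ℝ)
  have : ∑ n ∈ Finset.Icc 1 N, (omegaOn P n - S) ^ 2
      = ∑ n ∈ Finset.Icc 1 N, omegaOn P n ^ 2 - 2 * S * ∑ n ∈ Finset.Icc 1 N, omegaOn P n
        + N * S ^ 2 := by
    simp only [sub_sq, Finset.sum_add_distrib, Finset.sum_sub_distrib, Finset.mul_sum,
      Finset.sum_const, Nat.card_Icc, nsmul_eq_mul, Nat.add_sub_cancel]
    congr 2
    exact Finset.sum_congr rfl fun _ _ => by ring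
  rw [this, h1]
  nlinarith

theorem sum_Icc_factorization {p : ℕ} (N : ℕ) :
    ∑ n ∈ Finset.Icc 1 N, n.factorization p = N.factorial.factorization p := by
  induction N with
  | zero => simp
  | succ N ih =>
    rw [Finset.sum_Icc_succ_top (by omega), ih, Nat.factorial_succ,
      Nat.factorization_mul (by omega) N.factorial_ne_zero, Finsupp.add_apply, add_comm]

theorem sum_one_div_pred_sub_one_div_le_one (hP : ∀ p ∈ P, 2 ≤ p) :
    ∑ p ∈ P, (1 / ((p : ℝ) - 1) - 1 / p) ≤ 1 := by
  have htel (m : ℕ) : ∑ i ∈ Finset.Ico 2 (m + 2), (1 / ((i : ℝ) - 1) - 1 / i)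
      = 1 - 1 / (m + 1) := by
    induction m with
    | zero => simp
    | succ m ih =>
      rw [show m + 1 + 2 = m + 2 + 1 by ring, Finset.sum_Ico_succ_top (by omega), ih]
      push_cast
      rw [show (m : ℝ) + 2 - 1 = m + 1 by ring, show (m : ℝ) + 1 + 1 = m + 2 by ring]
      ring
  have hsub : P ⊆ Finset.Ico 2 (P.sup id + 2) := fun p hp =>
    Finset.mem_Ico.2 ⟨hP p hp, by have := Finset.le_sup (f := id) hp; simp only [id] at this; omega⟩
  refine (Finset.sum_le_sum_of_subset_of_nonneg hsub fun i hi _ => ?_).trans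
    ((htel _).trans_le (by simp only [sub_le_self_iff]; positivity))
  have : (2 : ℝ) ≤ i := by exact_mod_cast (Finset.mem_Ico.1 hi).1
  rw [sub_nonneg]
  exact one_div_le_one_div_of_le (by linarith) (by linarith)

theorem sum_bigOmegaOn_sub_omegaOn_le (hP : ∀ p ∈ P, p.Prime) {N : ℕ} (hN : ∏ p ∈ P, p ∣ N) :
    ∑ n ∈ Finset.Icc 1 N, ((bigOmegaOn P n : ℝ) - omegaOn P n) ≤ N := by
  have h1 : ∑ n ∈ Finset.Icc 1 N, (bigOmegaOn P n : ℝ) ≤ ∑ p ∈ P, (N : ℝ) * (1 / ((p : ℝ) - 1)) := by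
    simp only [bigOmegaOn, Nat.cast_sum]
    rw [Finset.sum_comm]
    refine Finset.sum_le_sum fun p hp => ?_
    rw [← Nat.cast_sum, sum_Icc_factorization, mul_one_div]
    refine (Nat.cast_le.2 (Nat.factorization_factorial_le_div_pred (hP p hp) N)).trans ?_
    refine Nat.cast_div_le.trans_eq ?_
    rw [Nat.cast_pred (hP p hp).pos]
  have h2 := mul_le_mul_of_nonneg_left
    (sum_one_div_pred_sub_one_div_le_one fun p hp => (hP p hp).two_le) (Nat.cast_nonneg (α := ℝ) N)
  rw [Finset.sum_sub_distrib, sum_omegaOn hN]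
  rw [Finset.sum_sub_distrib, mul_sub, Finset.mul_sum] at h2
  linarith

theorem omegaOn_le_bigOmegaOn (hP : ∀ p ∈ P, p.Prime) {n : ℕ} (hn : n ≠ 0) :
    omegaOn P n ≤ bigOmegaOn P n := by
  rw [omegaOn, bigOmegaOn, Nat.cast_sum]
  refine Finset.sum_le_sum fun p hp => ?_
  split_ifs with h
  · exact_mod_cast (hP p hp).factorization_pos_of_dvd hn h
  · positivity

theorem card_filter_mul_le_sum {s : Finset ℕ} {q : ℕ → Prop} [DecidablePred q] {f : ℕ → ℝ} {c : ℝ}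
    (hf : ∀ n ∈ s, 0 ≤ f n) (hq : ∀ n ∈ s, q n → c ≤ f n) :
    ((s.filter q).card : ℝ) * c ≤ ∑ n ∈ s, f n := by
  rw [← nsmul_eq_mul]
  refine (Finset.card_nsmul_le_sum _ f c fun n hn => ?_).trans
    (Finset.sum_le_sum_of_subset_of_nonneg (Finset.filter_subset _ _) fun n hn _ => hf n hn)
  exact hq n (Finset.mem_filter.1 hn).1 (Finset.mem_filter.1 hn).2

theorem card_notMem_manyFactors_mul_le (hP : ∀ p ∈ P, p.Prime) {N k : ℕ}
    (hN : ∏ p ∈ P, p ∣ N) (hS : 12 ≤ ∑ p ∈ P, (1 / p : ℝ))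
    (hk : (k : ℝ) ≤ 2 / 3 * (∑ p ∈ P, (1 / p : ℝ)) + 1) :
    (((Finset.Icc 1 N).filter (fun n => n ∉ manyFactors P k)).card : ℝ) *
      (∑ p ∈ P, (1 / p : ℝ)) ≤ 16 * N := by
  have hvar := sum_omegaOn_sub_sq_le hP hN
  set S := ∑ p ∈ P, (1 / p : ℝ)
  have h := card_filter_mul_le_sum (s := Finset.Icc 1 N) (q := fun n => n ∉ manyFactors P k)
    (f := fun n => (omegaOn P n - S) ^ 2) (c := S ^ 2 / 16) (fun n _ => sq_nonneg _) ?_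
  · have : 0 < S := by linarith
    refine le_of_mul_le_mul_right ?_ this
    linarith [h.trans hvar]
  · intro n hn hnk
    have hn0 : 0 < n := (Finset.mem_Icc.1 hn).1
    have hlt : bigOmegaOn P n < k := by
      by_contra! hge
      exact hnk ⟨hn0, hge⟩
    have hlt' : (bigOmegaOn P n : ℝ) < k := by exact_mod_cast hlt
    have := omegaOn_le_bigOmegaOn hP hn0.ne'
    nlinarith

theorem card_mem_manyFactors_mul_le (hP : ∀ p ∈ P, p.Prime) {N k : ℕ}
    (hN : ∏ p ∈ P, p ∣ N) (hS : 0 < ∑ p ∈ P, (1 / p : ℝ))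
    (hk : 4 / 3 * (∑ p ∈ P, (1 / p : ℝ)) ≤ k) :
    (((Finset.Icc 1 N).filter (fun n => n ∈ manyFactors P k)).card : ℝ) *
      (∑ p ∈ P, (1 / p : ℝ)) ≤ 42 * N := by
  have hvar := sum_omegaOn_sub_sq_le hP hN
  have hmul := sum_bigOmegaOn_sub_omegaOn_le hP hN
  set S := ∑ p ∈ P, (1 / p : ℝ)
  have hnn : ∀ n ∈ Finset.Icc 1 N, 0 ≤ (bigOmegaOn P n : ℝ) - omegaOn P n := fun n hn =>
    sub_nonneg.2 (omegaOn_le_bigOmegaOn hP (by have := (Finset.mem_Icc.1 hn).1; omega))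
  have h := card_filter_mul_le_sum (s := Finset.Icc 1 N) (q := fun n => n ∈ manyFactors P k)
    (f := fun n => 36 * (omegaOn P n - S) ^ 2 + 6 * S * ((bigOmegaOn P n : ℝ) - omegaOn P n))
    (c := S ^ 2) (fun n hn => ?_) ?_
  · rw [Finset.sum_add_distrib, ← Finset.mul_sum, ← Finset.mul_sum] at h
    refine le_of_mul_le_mul_right ?_ hS
    nlinarith
  · have := hnn n hn
    positivity
  · intro n hn hnk
    have hle : (k : ℝ) ≤ bigOmegaOn P n := by exact_mod_cast hnk.2
    have := hnn n hn
    by_cases hw : S / 6 ≤ omegaOn P n - S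
    · have : 0 ≤ 6 * S * ((bigOmegaOn P n : ℝ) - omegaOn P n) := by positivity
      nlinarith
    · have : S / 6 ≤ (bigOmegaOn P n : ℝ) - omegaOn P n := by linarith
      nlinarith [sq_nonneg (omegaOn P n - S)]

end Primes

theorem exists_primes_sum_one_div_gt (C : ℝ) :
    ∃ P : Finset ℕ, (∀ p ∈ P, p.Prime) ∧ C < ∑ p ∈ P, (1 / p : ℝ) := by
  have h := (not_summable_iff_tendsto_nat_atTop_of_nonneg fun n => by
    apply Set.indicator_nonneg; intros; positivity).1 not_summable_one_div_on_primes
  obtain ⟨n, hn⟩ := (h.eventually_gt_atTop C).exists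
  refine ⟨(Finset.range n).filter Nat.Prime, fun p hp => (Finset.mem_filter.1 hp).2, ?_⟩
  rw [Finset.sum_filter]
  simpa [Set.indicator_apply] using hn

theorem large_density_set_with_small_square_density
    (ε : ℝ) (hε0 : 0 < ε) (hε1 : ε < 1) :
    ∃ A : Set ℕ, (∀ n ∈ A, 0 < n) ∧
      (∃ d : ℝ, HasDensity A d ∧ 1 - ε < d) ∧
      (∃ d' : ℝ, HasDensity (A * A) d' ∧ d' < ε) := by
  obtain ⟨P, hP, hS⟩ := exists_primes_sum_one_div_gt (42 / ε)
  have hSε := (div_lt_iff₀ hε0).1 hS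
  set S := ∑ p ∈ P, (1 / p : ℝ) with hSdef
  have hS42 : 42 < S := by
    refine lt_of_le_of_lt ?_ hS
    rw [le_div_iff₀ hε0]
    linarith
  have hS0 : 0 < S := by linarith
  set k := ⌈2 / 3 * S⌉₊ with hkdef
  have hk1 : 2 / 3 * S ≤ k := Nat.le_ceil _
  have hk2 : (k : ℝ) ≤ 2 / 3 * S + 1 := (Nat.ceil_lt_add_one (by positivity)).le
  have hk0 : k ≠ 0 := (Nat.ceil_pos.2 (by positivity)).ne'
  have hQ (m : ℕ) : 0 < (∏ p ∈ P, p) ^ m :=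
    pow_pos (Finset.prod_pos fun q hq => (hP q hq).pos) m
  refine ⟨manyFactors P k, fun n hn => hn.1, ⟨_, hasDensity_manyFactors hP k, ?_⟩, ?_⟩
  · have hdvd : ∏ p ∈ P, p ∣ (∏ p ∈ P, p) ^ k := dvd_pow_self _ hk0
    have h := card_notMem_manyFactors_mul_le hP hdvd (by linarith) hk2
    have hsum := Finset.card_filter_add_card_filter_not
      (s := Finset.Icc 1 ((∏ p ∈ P, p) ^ k)) (fun n => n ∈ manyFactors P k)
    rw [Nat.card_Icc, Nat.add_sub_cancel] at hsum
    have hN : (0 : ℝ) < ((∏ p ∈ P, p) ^ k : ℕ) := Nat.cast_pos.2 (hQ k)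
    generalize (∏ p ∈ P, p) ^ k = N at *
    rw [← hSdef] at h
    rw [lt_div_iff₀ hN]
    have hsum' := congrArg (Nat.cast (R := ℝ)) hsum
    push_cast at hsum'
    refine lt_of_mul_lt_mul_right ?_ hS0.le
    nlinarith
  · rw [manyFactors_mul_self hP]
    refine ⟨_, hasDensity_manyFactors hP (2 * k), ?_⟩
    have hdvd : ∏ p ∈ P, p ∣ (∏ p ∈ P, p) ^ (2 * k) := dvd_pow_self _ (by omega)
    have h := card_mem_manyFactors_mul_le hP hdvd hS0 (k := 2 * k) (by push_cast; linarith)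
    have hN : (0 : ℝ) < ((∏ p ∈ P, p) ^ (2 * k) : ℕ) := Nat.cast_pos.2 (hQ (2 * k))
    generalize (∏ p ∈ P, p) ^ (2 * k) = N at *
    rw [← hSdef] at h
    rw [div_lt_iff₀ hN]
    refine lt_of_mul_lt_mul_right ?_ hS0.le
    nlinarith
end

section
/- Let Q(λ) = λ·log λ − λ + 1 for λ > 0. There exists an absolute constant C > 0 such that for all y ≥ 2 and all λ with 1 ≤ λ ≤ 1.99: the product over primes p ≤ y of (1 − 1/p), multiplied by the sum of 1/m over all positive integers m that are y-smooth and satisfy Ω(m) ≥ λ·log log y, is at most C·(log y)^{−Q(λ)}. -/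
open scoped Classical

/-- `Q λ = λ log λ − λ + 1` (for `λ > 0`). -/
noncomputable def Q (l : ℝ) : ℝ := l * Real.log l - l + 1

open Finset in
/-- The upper half of Mertens' first theorem. -/
theorem sum_log_div_prime_le {n : ℕ} (hn : n ≠ 0) :
    ∑ p ∈ (Icc 1 n).filter Nat.Prime, Real.log p / p ≤ Real.log n + Real.log 4 := by
  have hn' : (0 : ℝ) < n := by positivity
  have hdvd : ∏ p ∈ (Icc 1 n).filter Nat.Prime, p ^ (n / p) ∣ n.factorial := by
    apply Finset.prod_dvd_of_isRelPrime
    · intro p hp q hq hpq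
      rw [coe_filter, Set.mem_ofPred_eq] at hp hq
      exact Nat.coprime_iff_isRelPrime.1
        (Nat.Coprime.pow _ _ ((Nat.coprime_primes hp.2 hq.2).2 hpq))
    · intro p hp
      have hp0 : p ≠ 0 := (mem_filter.1 hp).2.ne_zero
      have h1 : ∀ k : ℕ, p ^ k ∣ (p * k).factorial := fun k => by
        induction k with
        | zero => simp
        | succ k ih =>
          rw [pow_succ, mul_comm]
          have : (p * (k + 1)).factorial = (p * (k + 1)) * (p * (k + 1) - 1).factorial :=
            (Nat.mul_factorial_pred (by positivity)).symm
          rw [this]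
          refine mul_dvd_mul (Dvd.intro _ rfl) (ih.trans (Nat.factorial_dvd_factorial ?_))
          have := Nat.pos_of_ne_zero hp0
          rw [mul_add]; omega
      exact (h1 _).trans (Nat.factorial_dvd_factorial (Nat.mul_div_le n p))
  have hle : ((∏ p ∈ (Icc 1 n).filter Nat.Prime, p ^ (n / p) : ℕ) : ℝ) ≤ (n : ℝ) ^ n :=
    mod_cast (Nat.le_of_dvd (Nat.factorial_pos n) hdvd).trans n.factorial_le_pow
  have hlog : ∑ p ∈ (Icc 1 n).filter Nat.Prime, ((n / p : ℕ) : ℝ) * Real.log p ≤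
      n * Real.log n := by
    have hpos : ∀ p ∈ (Icc 1 n).filter Nat.Prime, ((p : ℝ) ^ (n / p)) ≠ 0 := fun p hp =>
      pow_ne_zero _ (mod_cast (mem_filter.1 hp).2.ne_zero)
    have h := Real.log_le_log (by
      push_cast
      exact prod_pos fun p hp => by
        have := (mem_filter.1 hp).2.pos
        positivity) hle
    push_cast at h
    rw [Real.log_prod hpos, Real.log_pow] at h
    simpa only [Real.log_pow] using h
  have htheta : ∑ p ∈ (Icc 1 n).filter Nat.Prime, Real.log p ≤ Real.log 4 * n := by
    simpa [Chebyshev.theta, ← Icc_add_one_left_eq_Ioc] using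
      Chebyshev.theta_le_log4_mul_x (x := n) (by positivity)
  refine le_of_mul_le_mul_left ?_ hn'
  calc (n : ℝ) * ∑ p ∈ (Icc 1 n).filter Nat.Prime, Real.log p / p
      ≤ ∑ p ∈ (Icc 1 n).filter Nat.Prime, (((n / p : ℕ) : ℝ) * Real.log p + Real.log p) := by
        rw [mul_sum]
        refine sum_le_sum fun p hp => ?_
        have hp := (mem_filter.1 hp).2
        have h0 : 0 ≤ Real.log p := Real.log_natCast_nonneg p
        have h1 : (n : ℝ) / p ≤ ((n / p : ℕ) : ℝ) + 1 := by
          rw [← Nat.floor_div_eq_div (K := ℝ)]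
          exact (Nat.lt_floor_add_one _).le
        calc (n : ℝ) * (Real.log p / p) = n / p * Real.log p := by ring
          _ ≤ (((n / p : ℕ) : ℝ) + 1) * Real.log p := by gcongr
          _ = _ := by ring
    _ ≤ n * (Real.log n + Real.log 4) := by
        rw [sum_add_distrib]
        linarith

/-- The upper half of Mertens' second theorem, with an explicit constant. -/
theorem sum_one_div_prime_le {n : ℕ} (hn : 2 ≤ n) :
    ∑ p ∈ (Finset.Icc 1 n).filter Nat.Prime, 1 / (p : ℝ) ≤
      Real.log (Real.log n) + (1 + Real.log 4 / Real.log 2 - Real.log (Real.log 2)) := by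
  set c := Real.log 4
  have hmono : ∀ m : ℕ, 2 ≤ m →
      ∑ p ∈ (Finset.Icc 1 m).filter Nat.Prime, 1 / (p : ℝ)
        - (∑ p ∈ (Finset.Icc 1 m).filter Nat.Prime, Real.log p / p) / Real.log m
        + c / Real.log m - Real.log (Real.log m) ≤ c / Real.log 2 - Real.log (Real.log 2) := by
    intro m hm
    induction m, hm using Nat.le_induction with
    | base =>
      have h2 : Real.log 2 ≠ 0 := (Real.log_pos one_lt_two).ne'
      have : (Finset.Icc 1 2).filter Nat.Prime = {2} := by decide
      rw [this]
      simp
      field_simp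
      simp
    | succ m hm ih =>
      refine le_trans ?_ ih
      have hm1 : (1 : ℝ) < m := by exact_mod_cast hm
      have hL : 0 < Real.log m := Real.log_pos hm1
      have hL' : 0 < Real.log (m + 1 : ℕ) := Real.log_pos (by push_cast; linarith)
      have hLL : Real.log m ≤ Real.log (m + 1 : ℕ) :=
        Real.log_le_log (by linarith) (by push_cast; linarith)
      have hA := sum_log_div_prime_le (n := m) (by omega)
      have hr := Real.one_sub_inv_le_log_of_pos (div_pos hL' hL)
      rw [Real.log_div hL'.ne' hL.ne', inv_div] at hr
      have hstep : (∑ p ∈ (Finset.Icc 1 (m + 1)).filter Nat.Prime, 1 / (p : ℝ))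
          - (∑ p ∈ (Finset.Icc 1 (m + 1)).filter Nat.Prime, Real.log p / p)
            / Real.log (m + 1 : ℕ) =
          (∑ p ∈ (Finset.Icc 1 m).filter Nat.Prime, 1 / (p : ℝ))
          - (∑ p ∈ (Finset.Icc 1 m).filter Nat.Prime, Real.log p / p)
            / Real.log (m + 1 : ℕ) := by
        rw [Finset.sum_filter, Finset.sum_filter, Finset.sum_filter, Finset.sum_filter,
          Finset.sum_Icc_succ_top (by omega), Finset.sum_Icc_succ_top (by omega)]
        split_ifs
        · field_simp
          ring
        · simp
      set A := ∑ p ∈ (Finset.Icc 1 m).filter Nat.Prime, Real.log p / p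
      set L := Real.log m
      set L' := Real.log (m + 1 : ℕ)
      have hdiff : 0 ≤ 1 / L - 1 / L' := sub_nonneg.2 (one_div_le_one_div_of_le hL hLL)
      have h1 : A * (1 / L - 1 / L') ≤ (L + c) * (1 / L - 1 / L') := by gcongr
      have h2 : (L + c) * (1 / L - 1 / L') = 1 - L / L' + (c / L - c / L') := by
        field_simp
      have h3 : A * (1 / L - 1 / L') = A / L - A / L' := by ring
      linarith
  have h := hmono n hn
  have hL : 0 < Real.log n := Real.log_pos (by exact_mod_cast hn)
  have hA := div_le_div_of_nonneg_right (sum_log_div_prime_le (n := n) (by omega)) hL.le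
  rw [add_div, div_self hL.ne'] at hA
  linarith

/-- The completely multiplicative function `m ↦ l ^ Ω(m) / m`. -/
noncomputable def powCardFactorsDiv (l : ℝ) : ℕ →* ℝ where
  toFun m := l ^ m.primeFactorsList.length / m
  map_one' := by simp
  map_mul' m n := by
    rcases eq_or_ne m 0 with rfl | hm
    · simp
    rcases eq_or_ne n 0 with rfl | hn
    · simp
    have h := ArithmeticFunction.cardFactors_mul hm hn
    simp only [ArithmeticFunction.cardFactors_apply] at h
    rw [h, pow_add]
    push_cast
    exact (div_mul_div_comm _ _ _ _).symm

theorem powCardFactorsDiv_prime (l : ℝ) {p : ℕ} (hp : p.Prime) :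
    powCardFactorsDiv l p = l / p := by
  simp [powCardFactorsDiv, Nat.primeFactorsList_prime hp]

/-- Rankin's bound for the sum of reciprocals of smooth numbers with many prime factors. -/
theorem tsum_smooth_many_prime_factors_le {y l t : ℝ} (h1 : 1 ≤ l) (h2 : l < 2) :
    (∑' m : ℕ, if 1 ≤ m ∧ (∀ p : ℕ, p.Prime → p ∣ m → (p : ℝ) ≤ y) ∧
        t ≤ (m.primeFactorsList.length : ℝ) then 1 / (m : ℝ) else 0) ≤
      l ^ (-t) * ∏ p ∈ (Finset.Icc 1 ⌊y⌋₊).filter Nat.Prime, (1 - l / (p : ℝ))⁻¹ := by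
  have hl : 0 < l := by linarith
  have hlt : ∀ {p : ℕ}, p.Prime → ‖powCardFactorsDiv l p‖ < 1 := fun {p} hp => by
    have : (2 : ℝ) ≤ p := mod_cast hp.two_le
    rw [powCardFactorsDiv_prime l hp, Real.norm_of_nonneg (by positivity),
      div_lt_one (by positivity)]
    linarith
  have hsum := (EulerProduct.summable_and_hasSum_factoredNumbers_prod_filter_prime_geometric
    hlt (Finset.Icc 1 ⌊y⌋₊)).2
  have hprod : ∏ p ∈ (Finset.Icc 1 ⌊y⌋₊).filter Nat.Prime, (1 - powCardFactorsDiv l p)⁻¹ =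
      ∏ p ∈ (Finset.Icc 1 ⌊y⌋₊).filter Nat.Prime, (1 - l / (p : ℝ))⁻¹ :=
    Finset.prod_congr rfl fun p hp => by
      rw [powCardFactorsDiv_prime l (Finset.mem_filter.1 hp).2]
  rw [hprod] at hsum
  replace hsum := hasSum_subtype_iff_indicator (f := fun m => powCardFactorsDiv l m) |>.1 hsum
  have hsum' := hsum.mul_left (l ^ (-t))
  have hle : ∀ m : ℕ, (if 1 ≤ m ∧ (∀ p : ℕ, p.Prime → p ∣ m → (p : ℝ) ≤ y) ∧
      t ≤ (m.primeFactorsList.length : ℝ) then 1 / (m : ℝ) else 0) ≤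
      l ^ (-t) * (Nat.factoredNumbers (Finset.Icc 1 ⌊y⌋₊)).indicator
        (fun m => powCardFactorsDiv l m) m := fun m => by
    have hnonneg : ∀ k, 0 ≤ powCardFactorsDiv l k := fun k => by
      change 0 ≤ l ^ _ / (k : ℝ)
      positivity
    split_ifs with h
    · obtain ⟨hm, hp, ht⟩ := h
      rw [Set.indicator_of_mem]
      · change _ ≤ l ^ (-t) * (l ^ _ / (m : ℝ))
        rw [← mul_div_assoc, ← Real.rpow_natCast, ← Real.rpow_add hl]
        gcongr
        exact Real.one_le_rpow h1 (by linarith)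
      · rw [Nat.mem_factoredNumbers']
        intro p hpp hpm
        exact Finset.mem_Icc.2 ⟨hpp.one_le, Nat.le_floor (hp p hpp hpm)⟩
    · exact mul_nonneg (by positivity) (Set.indicator_nonneg (fun k _ => hnonneg k) m)
  refine (Summable.tsum_le_tsum hle (Summable.of_nonneg_of_le (fun m => ?_) hle hsum'.summable)
    hsum'.summable).trans_eq hsum'.tsum_eq
  split_ifs <;> positivity

theorem one_sub_mul_inv_one_sub_le {p l : ℝ} (hp : 2 ≤ p) (h1 : 1 ≤ l) (h2 : l ≤ 1.99) :
    (1 - 1 / p) * (1 - l / p)⁻¹ ≤ Real.exp ((l - 1) * (1 / p) + 400 * (1 / p ^ 2)) := by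
  have hpl : p / 200 ≤ p - l := by linarith
  have hpl0 : 0 < p - l := by linarith
  have hp0 : p ≠ 0 := by positivity
  have heq : (1 - 1 / p) * (1 - l / p)⁻¹ =
      (l - 1) * (1 / p) + l * (l - 1) / (p * (p - l)) + 1 := by
    have : 1 - l / p = (p - l) / p := by field_simp
    rw [this]
    field_simp
    ring
  have hquad : l * (l - 1) / (p * (p - l)) ≤ 400 * (1 / p ^ 2) := by
    calc l * (l - 1) / (p * (p - l)) ≤ 2 / (p * (p / 200)) := by
          gcongr
          nlinarith
      _ = 400 * (1 / p ^ 2) := by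
          field_simp
          norm_num
  rw [heq]
  exact (Real.add_one_le_exp _).trans (Real.exp_le_exp.2 (by linarith))

theorem smooth_many_prime_factors_sum_bound :
    ∃ C : ℝ, 0 < C ∧ ∀ y l : ℝ, 2 ≤ y → 1 ≤ l → l ≤ 1.99 →
      (∏ p ∈ (Finset.Icc 1 ⌊y⌋₊).filter Nat.Prime, (1 - 1 / (p : ℝ))) *
        (∑' m : ℕ,
          if 1 ≤ m ∧ (∀ p : ℕ, p.Prime → p ∣ m → (p : ℝ) ≤ y) ∧
              l * Real.log (Real.log y) ≤ (m.primeFactorsList.length : ℝ)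
          then 1 / (m : ℝ) else 0)
      ≤ C * Real.log y ^ (-Q l) := by
  set K := 1 + Real.log 4 / Real.log 2 - Real.log (Real.log 2)
  set Z := ∑' n : ℕ, 1 / (n : ℝ) ^ 2
  have hK : 0 ≤ K := by
    have h1 : 0 < Real.log 2 := Real.log_pos one_lt_two
    have h2 : 0 ≤ Real.log 4 / Real.log 2 := by positivity
    have h3 : Real.log (Real.log 2) ≤ 0 :=
      Real.log_nonpos h1.le (by linarith [Real.log_two_lt_d9])
    change 0 ≤ 1 + _ - _
    linarith
  refine ⟨Real.exp (K + 400 * Z), Real.exp_pos _, fun y l hy h1 h2 => ?_⟩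
  have hlog : 0 < Real.log y := Real.log_pos (by linarith)
  have hfloor : 2 ≤ ⌊y⌋₊ := Nat.le_floor (by exact_mod_cast hy)
  have hfloor_le : Real.log (Real.log ⌊y⌋₊) ≤ Real.log (Real.log y) := by
    have h : (1 : ℝ) < ⌊y⌋₊ := by exact_mod_cast hfloor
    exact Real.log_le_log (Real.log_pos h)
      (Real.log_le_log (by linarith) (Nat.floor_le (by linarith)))
  set s := (Finset.Icc 1 ⌊y⌋₊).filter Nat.Prime
  have htwo : ∀ p ∈ s, (2 : ℝ) ≤ p := fun p hp => mod_cast (Finset.mem_filter.1 hp).2.two_le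
  have hmertens : ∑ p ∈ s, 1 / (p : ℝ) ≤ Real.log (Real.log y) + K :=
    (sum_one_div_prime_le hfloor).trans (by linarith)
  have hsq : ∑ p ∈ s, 1 / (p : ℝ) ^ 2 ≤ Z :=
    (Real.summable_one_div_nat_pow.2 one_lt_two).sum_le_tsum s fun _ _ => by positivity
  have hnonneg : 0 ≤ ∏ p ∈ s, (1 - 1 / (p : ℝ)) := Finset.prod_nonneg fun p hp => by
    have := htwo p hp
    rw [sub_nonneg, div_le_one (by linarith)]
    linarith
  have hprod : ∏ p ∈ s, ((1 - 1 / (p : ℝ)) * (1 - l / (p : ℝ))⁻¹) ≤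
      Real.exp ((l - 1) * Real.log (Real.log y) + (K + 400 * Z)) := by
    calc ∏ p ∈ s, ((1 - 1 / (p : ℝ)) * (1 - l / (p : ℝ))⁻¹)
        ≤ ∏ p ∈ s, Real.exp ((l - 1) * (1 / (p : ℝ)) + 400 * (1 / (p : ℝ) ^ 2)) := by
          refine Finset.prod_le_prod (fun p hp => ?_) fun p hp =>
            one_sub_mul_inv_one_sub_le (htwo p hp) h1 h2
          have := htwo p hp
          refine mul_nonneg (sub_nonneg.2 ?_) (inv_nonneg.2 (sub_nonneg.2 ?_)) <;>
            rw [div_le_one (by linarith)] <;> linarith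
      _ = Real.exp ((l - 1) * ∑ p ∈ s, 1 / (p : ℝ) + 400 * ∑ p ∈ s, 1 / (p : ℝ) ^ 2) := by
          rw [← Real.exp_sum, Finset.sum_add_distrib, Finset.mul_sum, Finset.mul_sum]
      _ ≤ _ := by
          refine Real.exp_le_exp.2 ?_
          have h3 := mul_le_mul_of_nonneg_left hmertens (sub_nonneg.2 h1)
          have h4 : (l - 1) * K ≤ K := mul_le_of_le_one_left hK (by linarith)
          linarith
  calc _ ≤ (∏ p ∈ s, (1 - 1 / (p : ℝ))) * (l ^ (-(l * Real.log (Real.log y))) *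
          ∏ p ∈ s, (1 - l / (p : ℝ))⁻¹) :=
        mul_le_mul_of_nonneg_left
          (tsum_smooth_many_prime_factors_le h1 (by linarith)) hnonneg
    _ = l ^ (-(l * Real.log (Real.log y))) *
          ∏ p ∈ s, ((1 - 1 / (p : ℝ)) * (1 - l / (p : ℝ))⁻¹) := by
        rw [Finset.prod_mul_distrib]
        ring
    _ ≤ l ^ (-(l * Real.log (Real.log y))) *
          Real.exp ((l - 1) * Real.log (Real.log y) + (K + 400 * Z)) := by
        gcongr
    _ = Real.exp (K + 400 * Z) * Real.log y ^ (-Q l) := by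
        rw [Real.rpow_def_of_pos (by linarith : 0 < l), Real.rpow_def_of_pos hlog,
          ← Real.exp_add, ← Real.exp_add, Q]
        congr 1
        ring
end

section
/- Let P be a set of prime numbers such that the sum of 1/p over p ∈ P converges. Then the set of positive integers n having no prime factor in P has natural density equal to the (convergent) product over p ∈ P of (1 − 1/p). -/
open Filter Topology
open scoped Classical

/-- Removing the multiples of `q` from a set of integers sieved by numbers coprime to `q`. -/
lemma card_filter_not_dvd_insert {ι : Type*} (a : ι → ℕ) (S : Finset ι) {j : ι}
    (hpos : 0 < a j) (hcop : ∀ i ∈ S, (a i).Coprime (a j)) (N : ℕ) :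
    ((Finset.Icc 1 N).filter (fun n => ∀ i ∈ insert j S, ¬ a i ∣ n)).card
      + ((Finset.Icc 1 (N / a j)).filter (fun n => ∀ i ∈ S, ¬ a i ∣ n)).card
      = ((Finset.Icc 1 N).filter (fun n => ∀ i ∈ S, ¬ a i ∣ n)).card := by
  have hmul : ((Finset.Icc 1 (N / a j)).filter (fun n => ∀ i ∈ S, ¬ a i ∣ n)).card
      = (((Finset.Icc 1 N).filter (fun n => ∀ i ∈ S, ¬ a i ∣ n)).filter
          (fun n => a j ∣ n)).card := by
    refine Finset.card_bij (fun m _ => a j * m) ?_ ?_ ?_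
    · intro m hm
      simp only [Finset.mem_filter, Finset.mem_Icc] at hm ⊢
      obtain ⟨⟨h1, h2⟩, h3⟩ := hm
      refine ⟨⟨⟨Nat.mul_pos hpos h1, ?_⟩, fun i hi h => h3 i hi ?_⟩, dvd_mul_right _ _⟩
      · rw [mul_comm]
        exact (Nat.le_div_iff_mul_le hpos).1 h2
      · exact (hcop i hi).dvd_of_dvd_mul_left h
    · intro m _ m' _ h
      exact Nat.eq_of_mul_eq_mul_left hpos h
    · intro n hn
      simp only [Finset.mem_filter, Finset.mem_Icc] at hn
      obtain ⟨⟨⟨h1, h2⟩, h3⟩, m, rfl⟩ := hn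
      refine ⟨m, ?_, rfl⟩
      simp only [Finset.mem_filter, Finset.mem_Icc]
      refine ⟨⟨Nat.pos_of_mul_pos_left h1, ?_⟩, fun i hi h => h3 i hi (h.mul_left _)⟩
      rw [Nat.le_div_iff_mul_le hpos, mul_comm]
      exact h2
  rw [hmul, ← Finset.card_filter_add_card_filter_not (s := (Finset.Icc 1 N).filter
    (fun n => ∀ i ∈ S, ¬ a i ∣ n)) (fun n => a j ∣ n), add_comm]
  congr 2
  ext n
  simp only [Finset.mem_filter, Finset.forall_mem_insert]
  tauto

/-- Sieving by finitely many pairwise coprime moduli leaves a proportion `∏ (1 - 1 / a i)` of the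
integers, with bounded error. -/
lemma exists_abs_card_filter_not_dvd_sub_le {ι : Type*} (a : ι → ℕ) (hpos : ∀ i, 0 < a i)
    (hcop : Pairwise fun i j => (a i).Coprime (a j)) (S : Finset ι) :
    ∃ C : ℝ, ∀ N : ℕ,
      |(((Finset.Icc 1 N).filter (fun n => ∀ i ∈ S, ¬ a i ∣ n)).card : ℝ)
        - N * ∏ i ∈ S, (1 - 1 / (a i : ℝ))| ≤ C := by
  induction S using Finset.induction_on with
  | empty => exact ⟨0, fun N => by simp⟩
  | insert j S hj ih =>
    obtain ⟨C, hC⟩ := ih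
    refine ⟨C + C + |∏ i ∈ S, (1 - 1 / (a i : ℝ))|, fun N => ?_⟩
    have hcard := card_filter_not_dvd_insert a S (hpos j)
      (fun i hi => hcop (ne_of_mem_of_not_mem hi hj)) N
    have hcard' := congrArg (Nat.cast : ℕ → ℝ) hcard
    rw [Nat.cast_add] at hcard'
    rw [Finset.prod_insert hj, eq_sub_of_add_eq hcard']
    set Q := ∏ i ∈ S, (1 - 1 / (a i : ℝ))
    have hfloor : |(N : ℝ) / a j - (N / a j : ℕ)| ≤ 1 := by
      rw [← Nat.floor_div_eq_div (K := ℝ), abs_le]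
      have h1 := Nat.floor_le (a := (N : ℝ) / a j) (by positivity)
      have h2 := Nat.lt_floor_add_one ((N : ℝ) / a j)
      constructor <;> linarith
    have hQ : |((N : ℝ) / a j - (N / a j : ℕ)) * Q| ≤ |Q| := by
      rw [abs_mul]
      exact mul_le_of_le_one_left (abs_nonneg _) hfloor
    have h1 := abs_le.1 (hC N)
    have h2 := abs_le.1 (hC (N / a j))
    have h3 := abs_le.1 hQ
    have h4 : (N : ℝ) * ((1 - 1 / (a j : ℝ)) * Q) = N * Q - N / a j * Q := by ring
    rw [h4, abs_le]
    constructor <;> linarith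

/-- Sieving further by `T` removes at most `∑ i ∈ T, N / a i` integers up to `N`. -/
lemma card_filter_not_dvd_le_add_sum {ι : Type*} (a : ι → ℕ) (S T : Finset ι) (A : Set ℕ) (N : ℕ)
    (hA : ∀ n ∈ Finset.Icc 1 N, (∀ i ∈ S, ¬ a i ∣ n) → (∀ i ∈ T, ¬ a i ∣ n) → n ∈ A) :
    (((Finset.Icc 1 N).filter (fun n => ∀ i ∈ S, ¬ a i ∣ n)).card : ℝ)
      ≤ ((Finset.Icc 1 N).filter (fun n => n ∈ A)).card + N * ∑ i ∈ T, 1 / (a i : ℝ) := by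
  have hsub : (Finset.Icc 1 N).filter (fun n => ∀ i ∈ S, ¬ a i ∣ n)
      ⊆ (Finset.Icc 1 N).filter (fun n => n ∈ A)
        ∪ T.biUnion (fun i => (Finset.Ioc 0 N).filter (fun n => a i ∣ n)) := by
    intro n hn
    simp only [Finset.mem_union, Finset.mem_filter, Finset.mem_biUnion] at hn ⊢
    by_cases h : ∀ i ∈ T, ¬ a i ∣ n
    · exact Or.inl ⟨hn.1, hA n hn.1 hn.2 h⟩
    · push Not at h
      obtain ⟨i, hi, hd⟩ := h
      exact Or.inr ⟨i, hi, by simpa [Nat.succ_le_iff] using hn.1, hd⟩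
  have hcard := (Finset.card_le_card hsub).trans ((Finset.card_union_le _ _).trans
    (Nat.add_le_add_left Finset.card_biUnion_le _))
  simp only [Nat.Ioc_filter_dvd_card_eq_div] at hcard
  refine (Nat.cast_le (α := ℝ).2 hcard).trans ?_
  push_cast
  rw [Finset.mul_sum]
  gcongr with i
  rw [mul_one_div]
  exact Nat.cast_div_le

theorem density_of_P_free_integers
    (P : Set ℕ) (hP : ∀ p ∈ P, p.Prime)
    (hsum : Summable (fun p : P => 1 / (p : ℝ))) :
    HasDensity {n : ℕ | 1 ≤ n ∧ ∀ p ∈ P, ¬ p ∣ n}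
      (∏' p : P, (1 - 1 / (p : ℝ))) := by
  have hmult : Multipliable (fun p : P => 1 - 1 / (p : ℝ)) := by
    simpa [sub_eq_add_neg] using Real.multipliable_one_add_of_summable hsum.neg
  have hcop : Pairwise fun i j : P => (i : ℕ).Coprime j := fun i j hij =>
    (Nat.coprime_primes (hP i i.2) (hP j j.2)).2 (Subtype.coe_injective.ne hij)
  obtain ⟨A, hA⟩ : ∃ A : Set ℕ, A = {n : ℕ | 1 ≤ n ∧ ∀ p ∈ P, ¬ p ∣ n} := ⟨_, rfl⟩
  rw [← hA, HasDensity, Metric.tendsto_atTop]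
  intro ε hε
  obtain ⟨S₁, hS₁⟩ := summable_iff_vanishing_norm.1 hsum (ε / 3) (by positivity)
  obtain ⟨S₂, hS₂⟩ := (Metric.tendsto_atTop.1 hmult.hasProd) (ε / 3) (by positivity)
  set S := S₁ ∪ S₂
  obtain ⟨C, hC⟩ := exists_abs_card_filter_not_dvd_sub_le (fun p : P => (p : ℕ))
    (fun p => (hP p p.2).pos) hcop S
  obtain ⟨M, hM⟩ := exists_nat_gt (C / (ε / 3))
  refine ⟨M + 1, fun N hN => ?_⟩
  have hN0 : (0 : ℝ) < N := by exact_mod_cast (by omega : 0 < N)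
  have hCN : C < N * (ε / 3) := by
    rw [div_lt_iff₀ (by positivity)] at hM
    have : (M : ℝ) ≤ N := by exact_mod_cast (by omega : M ≤ N)
    exact hM.trans_le (by gcongr)
  have hprod := hS₂ S Finset.subset_union_right
  set T : Finset P := (Finset.Icc 1 N).subtype (· ∈ P) \ S
  have htail := hS₁ T (Finset.disjoint_of_subset_right Finset.subset_union_left
    Finset.sdiff_disjoint)
  have hlower := card_filter_not_dvd_le_add_sum (fun p : P => (p : ℕ)) S T A N (by
      intro n hn hS hT
      rw [Finset.mem_Icc] at hn
      rw [hA]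
      refine ⟨hn.1, fun p hp hd => ?_⟩
      by_cases hpS : (⟨p, hp⟩ : P) ∈ S
      · exact hS _ hpS hd
      · refine hT ⟨p, hp⟩ ?_ hd
        simp only [T, Finset.mem_sdiff, Finset.mem_subtype, Finset.mem_Icc]
        exact ⟨⟨(hP p hp).pos, (Nat.le_of_dvd hn.1 hd).trans hn.2⟩, hpS⟩)
  have hupper : (((Finset.Icc 1 N).filter (fun n => n ∈ A)).card : ℝ)
      ≤ ((Finset.Icc 1 N).filter (fun n => ∀ p ∈ S, ¬ (p : ℕ) ∣ n)).card := by
    refine Nat.cast_le.2 (Finset.card_le_card fun n hn => ?_)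
    rw [Finset.mem_filter, hA] at hn
    rw [Finset.mem_filter]
    exact ⟨hn.1, fun p _ => hn.2.2 p p.2⟩
  have hC' := abs_le.1 (hC N)
  have htail' := mul_lt_mul_of_pos_left (abs_lt.1 (Real.norm_eq_abs _ ▸ htail)).2 hN0
  rw [Real.dist_eq, abs_lt] at hprod ⊢
  have hprod₁ := mul_lt_mul_of_pos_left hprod.1 hN0
  have hprod₂ := mul_lt_mul_of_pos_left hprod.2 hN0
  rw [lt_sub_iff_add_lt, sub_lt_iff_lt_add, lt_div_iff₀ hN0, div_lt_iff₀ hN0]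
  constructor <;> linarith
end

section
/- Fix a real number y ≥ 1, a positive integer k, and a set P of prime numbers all exceeding y with ∑_{p∈P} 1/p < ∞. Let B_{y,k,P} be the set of positive integers n such that Ω_y(n) ≥ k and n is coprime to every p ∈ P. Then the natural density of B_{y,k,P} exists and equals ∏_{p∈P}(1 − 1/p) · ∏_{p ≤ y, p prime}(1 − 1/p) · ∑ 1/m, where the sum runs over all y-smooth positive integers m with Ω(m) ≥ k. -/
open Filter Topology
open scoped Classical

/-- `OmegaLe y n` is the number of prime factors of `n` that are `≤ y`,
counted with multiplicity. -/
noncomputable def OmegaLe (y : ℝ) (n : ℕ) : ℕ :=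
  (n.primeFactorsList.filter (fun p => (p : ℝ) ≤ y)).length

/-- `B y k P` is the set of positive integers `n` with `Ω_y(n) ≥ k` that are
coprime to every member of `P`. -/
noncomputable def B (y : ℝ) (k : ℕ) (P : Set ℕ) : Set ℕ :=
  {n : ℕ | 1 ≤ n ∧ k ≤ OmegaLe y n ∧ ∀ p ∈ P, Nat.Coprime n p}

/-- The number of elements of `A` in `[1, N]`. -/
noncomputable def countUpTo (A : Set ℕ) (N : ℕ) : ℕ :=
  ((Finset.Icc 1 N).filter (fun n => n ∈ A)).card

lemma countUpTo_eq_zero {A : Set ℕ} {N : ℕ} (hA : ∀ n ∈ Finset.Icc 1 N, n ∉ A) :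
    countUpTo A N = 0 :=
  Finset.card_eq_zero.2 (Finset.filter_eq_empty_iff.2 hA)

lemma HasDensity.congr {A A' : Set ℕ} {d : ℝ} (h : HasDensity A d)
    (hA : ∀ n, 1 ≤ n → (n ∈ A' ↔ n ∈ A)) : HasDensity A' d := by
  unfold HasDensity at h ⊢
  refine h.congr fun N => ?_
  congr 3
  refine Finset.filter_congr fun n hn => ?_
  exact (hA n (Finset.mem_Icc.1 hn).1).symm

lemma HasDensity.empty : HasDensity ∅ 0 := by
  simp [HasDensity]

lemma HasDensity.univ : HasDensity Set.univ 1 := by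
  unfold HasDensity
  refine tendsto_const_nhds.congr' ?_
  filter_upwards [eventually_ge_atTop 1] with N hN
  have : (N : ℝ) ≠ 0 := by positivity
  simp [this]

lemma HasDensity.diff {A A' : Set ℕ} {d d' : ℝ} (h : HasDensity A d) (h' : HasDensity A' d')
    (hs : A' ⊆ A) : HasDensity (A \ A') (d - d') := by
  unfold HasDensity at *
  refine (h.sub h').congr fun N => ?_
  rw [← sub_div]
  congr 1
  have hsub : (Finset.Icc 1 N).filter (fun n => n ∈ A') ⊆ (Finset.Icc 1 N).filter (fun n => n ∈ A) :=
    Finset.monotone_filter_right _ fun n _ hn => hs hn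
  rw [← Nat.cast_sub (Finset.card_le_card hsub), ← Finset.card_sdiff_of_subset hsub]
  congr 2
  ext n
  simp only [Finset.mem_sdiff, Finset.mem_filter, Set.mem_sdiff]
  tauto

lemma HasDensity.dilate {A A' : Set ℕ} {d : ℝ} {m : ℕ} (h : HasDensity A d) (hm : 0 < m)
    (hA : ∀ n, 1 ≤ n → (n ∈ A' ↔ ∃ l ∈ A, n = m * l)) : HasDensity A' (1 / m * d) := by
  have hcard : ∀ N : ℕ, ((Finset.Icc 1 N).filter (fun n => n ∈ A')).card =
      ((Finset.Icc 1 (N / m)).filter (fun n => n ∈ A)).card := by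
    intro N
    symm
    refine Finset.card_bij (fun l _ => m * l) ?_ ?_ ?_
    · intro l hl
      simp only [Finset.mem_filter, Finset.mem_Icc] at hl ⊢
      have h1 : 1 ≤ m * l := Nat.mul_pos hm hl.1.1
      refine ⟨⟨h1, ?_⟩, (hA _ h1).2 ⟨l, hl.2, rfl⟩⟩
      rw [mul_comm]
      exact (Nat.le_div_iff_mul_le hm).1 hl.1.2
    · intro a _ b _ hab
      exact Nat.eq_of_mul_eq_mul_left hm hab
    · intro n hn
      simp only [Finset.mem_filter, Finset.mem_Icc] at hn
      obtain ⟨l, hl, rfl⟩ := (hA n hn.1.1).1 hn.2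
      refine ⟨l, ?_, rfl⟩
      simp only [Finset.mem_filter, Finset.mem_Icc]
      refine ⟨⟨Nat.pos_of_mul_pos_left hn.1.1, ?_⟩, hl⟩
      rw [Nat.le_div_iff_mul_le hm, mul_comm]
      exact hn.1.2
  have hfloor : Tendsto (fun N : ℕ => ((N / m : ℕ) : ℝ) / N) atTop (𝓝 (1 / m)) := by
    have h0 := (tendsto_nat_floor_mul_div_atTop (R := ℝ) (a := 1 / m) (by positivity)).comp
      tendsto_natCast_atTop_atTop
    refine h0.congr fun N => ?_
    simp only [Function.comp_apply]
    rw [one_div_mul_eq_div, Nat.floor_div_eq_div]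
  have hlim := hfloor.mul (h.comp (Nat.tendsto_div_const_atTop hm.ne'))
  unfold HasDensity
  refine hlim.congr fun N => ?_
  simp only [Function.comp_apply]
  rw [hcard]
  rcases Nat.eq_zero_or_pos (N / m) with h0 | h0
  · simp [h0]
  · have : ((N / m : ℕ) : ℝ) ≠ 0 := by positivity
    field_simp

/-- Tannery's theorem for densities: a set partitioned by the values of `g` has as density
the sum of the densities of the parts, provided the counts are dominated by a summable sequence. -/
lemma HasDensity.of_fibers {A : Set ℕ} (g : ℕ → ℕ) {d b : ℕ → ℝ} (hb : Summable b)
    (hd : ∀ m, HasDensity {n ∈ A | g n = m} (d m))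
    (hle : ∀ m N, (countUpTo {n ∈ A | g n = m} N : ℝ) / N ≤ b m) :
    HasDensity A (∑' m, d m) := by
  have hd' : ∀ m, Tendsto (fun N : ℕ => (countUpTo {n ∈ A | g n = m} N : ℝ) / N) atTop (𝓝 (d m)) :=
    hd
  unfold HasDensity
  refine (tendsto_tsum_of_dominated_convergence hb hd'
    (Eventually.of_forall fun N m => ?_)).congr fun N => ?_
  · rw [Real.norm_of_nonneg (by positivity)]
    exact hle m N
  · rw [tsum_div_const]
    congr 1
    rw [Finset.card_eq_sum_card_image g, Nat.cast_sum,
      tsum_eq_sum (s := ((Finset.Icc 1 N).filter (fun n => n ∈ A)).image g)]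
    · refine Finset.sum_congr rfl fun m _ => ?_
      rw [Finset.filter_filter, countUpTo]
      congr 2
      ext n
      simp
    · intro m hm
      rw [Nat.cast_eq_zero]
      refine countUpTo_eq_zero ?_
      rintro n hn ⟨hnA, hnm⟩
      exact hm (Finset.mem_image.2 ⟨n, Finset.mem_filter.2 ⟨hn, hnA⟩, hnm⟩)

lemma countUpTo_div_le_of_dvd {A : Set ℕ} {m : ℕ} (hA : ∀ n ∈ A, m ∣ n) (N : ℕ) :
    (countUpTo A N : ℝ) / N ≤ 1 / m := by
  have h1 : countUpTo A N ≤ N / m := by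
    rw [countUpTo, ← Nat.Ioc_filter_dvd_card_eq_div]
    refine Finset.card_le_card fun n hn => ?_
    simp only [Finset.mem_filter, Finset.mem_Icc, Finset.mem_Ioc] at hn ⊢
    exact ⟨⟨hn.1.1, hn.1.2⟩, hA n hn.2⟩
  have h2 : (countUpTo A N : ℝ) ≤ N / m :=
    (Nat.cast_le.2 h1).trans Nat.cast_div_le
  rcases Nat.eq_zero_or_pos N with rfl | hN
  · simp
  · rw [div_le_iff₀ (by positivity)]
    calc _ ≤ (N : ℝ) / m := h2
      _ = 1 / m * N := by ring

/-- The factor attached to `n` in the sieve by the set `Q`. -/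
noncomputable def sieveFactor (Q : Set ℕ) : ℕ → ℝ :=
  Q.mulIndicator fun n => 1 - 1 / (n : ℝ)

lemma hasDensity_sieve_range {Q : Set ℕ} (hQ : ∀ p ∈ Q, p.Prime) (N : ℕ) :
    HasDensity {n | ∀ q ∈ Q, q < N → ¬ q ∣ n} (∏ q ∈ Finset.range N, sieveFactor Q q) := by
  induction N with
  | zero => simpa using HasDensity.univ
  | succ N ih =>
    rw [Finset.prod_range_succ, sieveFactor]
    by_cases hN : N ∈ Q
    · rw [Set.mulIndicator_of_mem hN, mul_one_sub, mul_comm _ (1 / (N : ℝ))]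
      have hp := hQ N hN
      have hdil := ih.dilate (A' := {n | (∀ q ∈ Q, q < N → ¬ q ∣ n) ∧ N ∣ n}) hp.pos ?_
      · refine (ih.diff hdil fun n hn => hn.1).congr fun n _ => ?_
        simp only [Set.mem_sdiff, Set.mem_ofPred_eq, Nat.lt_succ_iff_lt_or_eq]
        constructor
        · intro h
          exact ⟨fun q hq hlt => h q hq (Or.inl hlt), fun h' => h N hN (Or.inr rfl) h'.2⟩
        · rintro ⟨h1, h2⟩ q hq (hlt | rfl)
          · exact h1 q hq hlt
          · exact fun hd => h2 ⟨h1, hd⟩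
      · intro n _
        constructor
        · rintro ⟨h1, l, rfl⟩
          exact ⟨l, fun q hq hlt hd => h1 q hq hlt (hd.mul_left _), rfl⟩
        · rintro ⟨l, hl, rfl⟩
          refine ⟨fun q hq hlt hd => ?_, Dvd.intro _ rfl⟩
          rcases (hQ q hq).dvd_mul.1 hd with h | h
          · exact hlt.ne ((Nat.prime_dvd_prime_iff_eq (hQ q hq) hp).1 h)
          · exact hl q hq hlt h
    · rw [Set.mulIndicator_of_notMem hN, mul_one]
      refine ih.congr fun n _ => ?_
      simp only [Set.mem_ofPred_eq, Nat.lt_succ_iff_lt_or_eq]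
      refine forall₂_congr fun q hq => ?_
      have : q ≠ N := fun h => hN (h ▸ hq)
      simp [this]

/-- The integers free of prime factors from `Q` have density `∏ (1 - 1/p)`. -/
lemma hasDensity_sieve {Q : Set ℕ} (hQ : ∀ p ∈ Q, p.Prime)
    (hsum : Summable fun p : Q => 1 / ((p : ℕ) : ℝ)) {δ : ℝ}
    (hδ : HasProd (fun p : Q => 1 - 1 / ((p : ℕ) : ℝ)) δ) :
    HasDensity {n | ∀ q ∈ Q, ¬ q ∣ n} δ := by
  have hprod : HasProd (sieveFactor Q) δ := hasProd_subtype_iff_mulIndicator.1 hδ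
  set D : ℕ → ℝ := fun N => ∏ q ∈ Finset.range N, sieveFactor Q q with hD
  have hb : Summable (Q.indicator fun n : ℕ => 1 / (n : ℝ)) := summable_subtype_iff_indicator.1 hsum
  set d : ℕ → ℝ := fun N => Q.indicator (fun n : ℕ => 1 / (n : ℝ)) N * D N with hd
  have hstep : ∀ N, d N = D N - D (N + 1) := by
    intro N
    simp only [hd, hD, Finset.prod_range_succ, sieveFactor]
    by_cases hN : N ∈ Q
    · simp only [Set.mulIndicator_of_mem hN, Set.indicator_of_mem hN]
      ring
    · simp [Set.mulIndicator_of_notMem hN, Set.indicator_of_notMem hN]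
  have hsumd : ∀ N, ∑ i ∈ Finset.range N, d i = 1 - D N := by
    intro N
    simp only [hstep]
    rw [Finset.sum_range_sub']
    simp [hD]
  have hfac : ∀ n, 0 ≤ sieveFactor Q n ∧ sieveFactor Q n ≤ 1 := by
    intro n
    by_cases hn : n ∈ Q
    · rw [sieveFactor, Set.mulIndicator_of_mem hn]
      have : (1 : ℝ) ≤ n := by exact_mod_cast (hQ n hn).one_le
      have h1 : 1 / (n : ℝ) ≤ 1 := by rw [div_le_one (by linarith)]; exact this
      have h2 : 0 ≤ 1 / (n : ℝ) := by positivity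
      constructor <;> linarith
    · simp [sieveFactor, Set.mulIndicator_of_notMem hn]
  have hd0 : ∀ N, 0 ≤ d N := fun N =>
    mul_nonneg (Set.indicator_nonneg (fun _ _ => by positivity) _)
      (Finset.prod_nonneg fun q _ => (hfac q).1)
  have htsum : ∑' N, d N = 1 - δ := by
    refine ((hasSum_iff_tendsto_nat_of_nonneg hd0 _).2 ?_).tsum_eq
    simp only [hsumd]
    exact tendsto_const_nhds.sub hprod.tendsto_prod_nat
  have hcompl : HasDensity {n | ∃ q ∈ Q, q ∣ n} (1 - δ) := by
    rw [← htsum]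
    have hmem : ∀ n ∈ {n | ∃ q ∈ Q, q ∣ n}, sInf {q | q ∈ Q ∧ q ∣ n} ∈ {q | q ∈ Q ∧ q ∣ n} :=
      fun n hn => Nat.sInf_mem hn
    refine HasDensity.of_fibers (fun n => sInf {q | q ∈ Q ∧ q ∣ n}) hb (fun m => ?_) fun m N => ?_
    · by_cases hm : m ∈ Q
      · simp only [hd, Set.indicator_of_mem hm]
        refine (hasDensity_sieve_range hQ m).dilate (hQ m hm).pos fun n _ => ?_
        constructor
        · rintro ⟨hn, rfl⟩
          obtain ⟨l, hl⟩ := (hmem n hn).2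
          refine ⟨l, fun q hq hlt hdvd => ?_, hl⟩
          refine Nat.notMem_of_lt_sInf hlt ⟨hq, ?_⟩
          rw [hl]
          exact hdvd.mul_left _
        · rintro ⟨l, hl, rfl⟩
          have hml : m * l ∈ {n | ∃ q ∈ Q, q ∣ n} := ⟨m, hm, Dvd.intro _ rfl⟩
          refine ⟨hml, le_antisymm (Nat.sInf_le ⟨hm, Dvd.intro _ rfl⟩) ?_⟩
          by_contra! hlt
          obtain ⟨h1, h2⟩ := hmem _ hml
          rcases (hQ _ h1).dvd_mul.1 h2 with h | h
          · exact hlt.ne ((Nat.prime_dvd_prime_iff_eq (hQ _ h1) (hQ m hm)).1 h)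
          · exact hl _ h1 hlt h
      · simp only [hd, Set.indicator_of_notMem hm, zero_mul]
        refine HasDensity.empty.congr fun n _ => ?_
        simp only [Set.mem_empty_iff_false, iff_false]
        rintro ⟨hn, rfl⟩
        exact hm (hmem n hn).1
    · by_cases hm : m ∈ Q
      · rw [Set.indicator_of_mem hm]
        refine countUpTo_div_le_of_dvd ?_ N
        rintro n ⟨hn, rfl⟩
        exact (hmem n hn).2
      · rw [Set.indicator_of_notMem hm, countUpTo_eq_zero]
        · simp
        · rintro n _ ⟨hn, rfl⟩
          exact hm (hmem n hn).1
  have := HasDensity.univ.diff hcompl (Set.subset_univ _)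
  rw [sub_sub_cancel] at this
  refine this.congr fun n _ => ?_
  simp

/-- The largest divisor of `n` all of whose prime factors are at most `y`. -/
noncomputable def smoothPart (y : ℝ) (n : ℕ) : ℕ :=
  (n.primeFactorsList.filter (fun p : ℕ => (p : ℝ) ≤ y)).prod

lemma primeFactorsList_smoothPart (y : ℝ) (n : ℕ) :
    (smoothPart y n).primeFactorsList.Perm
      (n.primeFactorsList.filter (fun p : ℕ => (p : ℝ) ≤ y)) :=
  (Nat.primeFactorsList_unique rfl fun _ hp =>
    Nat.prime_of_mem_primeFactorsList (List.mem_of_mem_filter hp)).symm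

lemma length_primeFactorsList_smoothPart (y : ℝ) (n : ℕ) :
    (smoothPart y n).primeFactorsList.length = OmegaLe y n := by
  rw [(primeFactorsList_smoothPart y n).length_eq, OmegaLe]
  simp only [bind_pure_comp, List.map_eq_map, List.filter_map, List.length_map]
  rfl

lemma smoothPart_dvd (y : ℝ) {n : ℕ} (hn : n ≠ 0) : smoothPart y n ∣ n := by
  conv_rhs => rw [← Nat.prod_primeFactorsList hn]
  exact List.filter_sublist.prod_dvd_prod

lemma smoothPart_pos (y : ℝ) (n : ℕ) : 0 < smoothPart y n :=
  List.prod_pos fun _ hp => (Nat.prime_of_mem_primeFactorsList (List.mem_of_mem_filter hp)).pos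

lemma le_of_prime_dvd_smoothPart {y : ℝ} {n p : ℕ} (hp : p.Prime) (h : p ∣ smoothPart y n) :
    (p : ℝ) ≤ y := by
  have h1 := (Nat.mem_primeFactorsList (smoothPart_pos y n).ne').2 ⟨hp, h⟩
  simpa using List.of_mem_filter ((primeFactorsList_smoothPart y n).mem_iff.1 h1)

lemma smoothPart_mul (y : ℝ) {a b : ℕ} (ha : a ≠ 0) (hb : b ≠ 0) :
    smoothPart y (a * b) = smoothPart y a * smoothPart y b := by
  rw [smoothPart, ((Nat.perm_primeFactorsList_mul ha hb).filter _).prod_eq, List.filter_append,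
    List.prod_append]
  rfl

lemma smoothPart_eq_self {y : ℝ} {m : ℕ} (hm : m ≠ 0)
    (h : ∀ p : ℕ, p.Prime → p ∣ m → (p : ℝ) ≤ y) : smoothPart y m = m := by
  rw [smoothPart, List.filter_eq_self.2, Nat.prod_primeFactorsList hm]
  intro p hp
  simpa using h p (Nat.prime_of_mem_primeFactorsList hp) (Nat.dvd_of_mem_primeFactorsList hp)

lemma smoothPart_eq_one {y : ℝ} {l : ℕ}
    (h : ∀ p : ℕ, p.Prime → (p : ℝ) ≤ y → ¬ p ∣ l) : smoothPart y l = 1 := by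
  rw [smoothPart, List.filter_eq_nil_iff.2, List.prod_nil]
  intro p hp
  simpa using fun hy => h p (Nat.prime_of_mem_primeFactorsList hp) hy
    (Nat.dvd_of_mem_primeFactorsList hp)

lemma summable_indicator_one_div_smooth (y : ℝ) :
    Summable ({m : ℕ | 1 ≤ m ∧ ∀ p : ℕ, p.Prime → p ∣ m → (p : ℝ) ≤ y}.indicator
      fun m : ℕ => 1 / (m : ℝ)) := by
  let f : ℕ →* ℝ :=
    { toFun := fun m => 1 / (m : ℝ)
      map_one' := by simp
      map_mul' := fun a b => by simp [mul_comm] }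
  have hf : ∀ {p : ℕ}, p.Prime → ‖f p‖ < 1 := by
    intro p hp
    have : (1 : ℝ) < p := by exact_mod_cast hp.one_lt
    change ‖1 / (p : ℝ)‖ < 1
    rw [Real.norm_of_nonneg (by positivity), div_lt_one (by linarith)]
    exact this
  have h := (EulerProduct.summable_and_hasSum_smoothNumbers_prod_primesBelow_geometric hf
    (⌊y⌋₊ + 1)).2.summable
  have h' := summable_subtype_iff_indicator.1 h
  refine h'.congr fun m => ?_
  congr 1
  ext m
  simp only [Set.mem_ofPred_eq, Nat.mem_smoothNumbers']
  constructor
  · intro h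
    have hm : m ∈ Nat.smoothNumbers (⌊y⌋₊ + 1) := Nat.mem_smoothNumbers'.2 h
    refine ⟨Nat.pos_of_ne_zero hm.1, fun p hp hd => ?_⟩
    exact (Nat.le_floor_iff' hp.ne_zero).1 (Nat.le_of_lt_succ (h p hp hd))
  · rintro ⟨_, h⟩ p hp hd
    exact Nat.lt_succ_of_le (Nat.le_floor (h p hp hd))

theorem density_of_B
    (y : ℝ) (hy : 1 ≤ y) (k : ℕ) (hk : 0 < k)
    (P : Set ℕ) (hP : ∀ p ∈ P, p.Prime ∧ y < (p : ℝ))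
    (hsum : Summable (fun p : P => 1 / (p : ℝ))) :
    HasDensity (B y k P)
      ((∏' p : P, (1 - 1 / (p : ℝ))) *
        (∏ p ∈ (Finset.Icc 1 ⌊y⌋₊).filter Nat.Prime, (1 - 1 / (p : ℝ))) *
        (∑' m : ℕ,
          if 1 ≤ m ∧ (∀ p : ℕ, p.Prime → p ∣ m → (p : ℝ) ≤ y) ∧
              k ≤ m.primeFactorsList.length
          then 1 / (m : ℝ) else 0)) := by
  set S : Set ℕ := ↑((Finset.Icc 1 ⌊y⌋₊).filter Nat.Prime) with hS
  have hmemS : ∀ p, p ∈ S ↔ p.Prime ∧ (p : ℝ) ≤ y := by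
    intro p
    simp only [hS, Finset.coe_filter, Finset.mem_Icc, Set.mem_ofPred_eq]
    constructor
    · rintro ⟨⟨_, h⟩, hp⟩
      exact ⟨hp, (Nat.le_floor_iff' hp.ne_zero).1 h⟩
    · rintro ⟨hp, h⟩
      exact ⟨⟨hp.one_le, Nat.le_floor h⟩, hp⟩
  have hdisj : Disjoint P S := Set.disjoint_left.2 fun p hp hpS =>
    absurd ((hmemS p).1 hpS).2 (not_le.2 (hP p hp).2)
  have hQ : ∀ p ∈ P ∪ S, p.Prime := by
    rintro p (hp | hp)
    · exact (hP p hp).1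
    · exact ((hmemS p).1 hp).1
  have hmult : Multipliable fun p : P => 1 - 1 / ((p : ℕ) : ℝ) := by
    simp only [sub_eq_add_neg]
    exact Real.multipliable_one_add_of_summable hsum.neg
  have hprodS : HasProd (fun p : S => 1 - 1 / ((p : ℕ) : ℝ))
      (∏ p ∈ (Finset.Icc 1 ⌊y⌋₊).filter Nat.Prime, (1 - 1 / (p : ℝ))) :=
    Finset.hasProd _ fun p : ℕ => 1 - 1 / (p : ℝ)
  have hδ := HasProd.mul_disjoint (f := fun p : ℕ => 1 - 1 / (p : ℝ)) hdisj hmult.hasProd hprodS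
  have hsumQ : Summable fun p : ↥(P ∪ S) => 1 / ((p : ℕ) : ℝ) :=
    (hsum.hasSum.add_disjoint (f := fun p : ℕ => 1 / (p : ℝ)) hdisj
      (Finset.hasSum _ fun p : ℕ => 1 / (p : ℝ))).summable
  have hsieve := hasDensity_sieve hQ hsumQ hδ
  have hpos : ∀ n ∈ B y k P, n ≠ 0 := fun n hn => Nat.one_le_iff_ne_zero.1 hn.1
  rw [← tsum_mul_left]
  refine HasDensity.of_fibers (smoothPart y) (summable_indicator_one_div_smooth y)
    (fun m => ?_) fun m N => ?_
  · split_ifs with hm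
    · obtain ⟨hm1, hmy, hmk⟩ := hm
      have hm0 : m ≠ 0 := Nat.one_le_iff_ne_zero.1 hm1
      rw [mul_comm]
      refine hsieve.dilate hm1 fun n hn => ?_
      constructor
      · rintro ⟨hnB, rfl⟩
        obtain ⟨l, hl⟩ := smoothPart_dvd y (hpos n hnB)
        refine ⟨l, ?_, hl⟩
        rintro q (hq | hq) hd
        · refine (hP q hq).1.coprime_iff_not_dvd.1 (hnB.2.2 q hq).symm ?_
          rw [hl]
          exact hd.mul_left _
        · have hl0 : l ≠ 0 := by
            rintro rfl
            exact hpos n hnB (by simpa using hl)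
          obtain ⟨hq, hqy⟩ := (hmemS q).1 hq
          have h1 : smoothPart y l = 1 := by
            have h2 := congrArg (smoothPart y) hl
            rw [smoothPart_mul y hm0 hl0, smoothPart_eq_self hm0 hmy] at h2
            exact (Nat.eq_of_mul_eq_mul_left hm1 (by rw [mul_one]; exact h2)).symm
          have h3 : q ∈ l.primeFactorsList.filter (fun p : ℕ => (p : ℝ) ≤ y) :=
            List.mem_filter.2 ⟨(Nat.mem_primeFactorsList hl0).2 ⟨hq, hd⟩, by simpa using hqy⟩
          exact hq.not_dvd_one (h1 ▸ List.dvd_prod h3)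
      · rintro ⟨l, hl, rfl⟩
        have hl0 : l ≠ 0 := by
          rintro rfl
          simp at hn
        have hsm : smoothPart y (m * l) = m := by
          rw [smoothPart_mul y hm0 hl0, smoothPart_eq_self hm0 hmy, smoothPart_eq_one, mul_one]
          exact fun p hp hpy => hl p (Or.inr ((hmemS p).2 ⟨hp, hpy⟩))
        refine ⟨⟨hn, ?_, fun p hp => ?_⟩, hsm⟩
        · rw [← length_primeFactorsList_smoothPart, hsm]
          exact hmk
        · obtain ⟨hpp, hpy⟩ := hP p hp
          refine (hpp.coprime_iff_not_dvd.2 fun hd => ?_).symm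
          rcases hpp.dvd_mul.1 hd with h | h
          · exact not_le.2 hpy (hmy p hpp h)
          · exact hl p (Or.inl hp) h
    · rw [mul_zero]
      refine HasDensity.empty.congr fun n _ => ?_
      simp only [Set.mem_empty_iff_false, iff_false]
      rintro ⟨hnB, rfl⟩
      refine hm ⟨smoothPart_pos y n, fun p => le_of_prime_dvd_smoothPart, ?_⟩
      rw [length_primeFactorsList_smoothPart]
      exact hnB.2.1
  · by_cases hm : m ∈ {m : ℕ | 1 ≤ m ∧ ∀ p : ℕ, p.Prime → p ∣ m → (p : ℝ) ≤ y}
    · rw [Set.indicator_of_mem hm]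
      refine countUpTo_div_le_of_dvd ?_ N
      rintro n ⟨hn, rfl⟩
      exact smoothPart_dvd y (hpos n hn)
    · rw [Set.indicator_of_notMem hm, countUpTo_eq_zero]
      · simp
      · rintro n _ ⟨hn, rfl⟩
        exact hm ⟨smoothPart_pos y n, fun p => le_of_prime_dvd_smoothPart⟩
end

section
/- For each positive integer k set y_k = exp(exp(4k/3)), so that k = (3/4)·log log y_k. Let δ_k be the natural density of the set {n ∈ ℕ : Ω_{y_k}(n) ≥ k} (which exists), and let δ'_k be the natural density of {n ∈ ℕ : Ω_{y_k}(n) ≥ 2k} (which exists). Then δ_k → 1 and δ'_k → 0 as k → ∞. -/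
open Filter Topology
open scoped Classical

/-- `yk k = exp(exp(4k/3))`, so that `k = (3/4) log log (yk k)`. -/
noncomputable def yk (k : ℕ) : ℝ := Real.exp (Real.exp (4 * k / 3))

open Finset in
/-- The number of elements of `[1, N]` satisfying a periodic predicate is linear in `N` up to a
bounded error, so the predicate has a natural density. -/
lemma exists_tendsto_card_filter_div_of_periodic {p : ℕ → Prop} {M : ℕ} (hM : 0 < M)
    (hp : Function.Periodic p M) :
    ∃ d : ℝ, Tendsto (fun N : ℕ => (#{n ∈ Icc 1 N | p n} : ℝ) / N) atTop (𝓝 d) := by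
  set c : ℕ := M.count p
  have hadd (N : ℕ) : #{n ∈ Icc 1 (N + M) | p n} = #{n ∈ Icc 1 N | p n} + c := by
    have h : #{n ∈ Ico (N + 1) (N + 1 + M) | p n} = c :=
      Nat.filter_Ico_card_eq_of_periodic (N + 1) M p hp
    rw [← h, ← card_union_of_disjoint, ← filter_union]
    · congr 2
      ext n
      simp only [mem_Icc, mem_union, mem_Ico]
      omega
    · refine disjoint_filter_filter (disjoint_left.2 fun n h1 h2 => ?_)
      simp only [mem_Icc, mem_Ico] at h1 h2
      omega
  set f : ℕ → ℝ := fun N => (#{n ∈ Icc 1 N | p n} : ℝ) - N * (c / M)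
  have hM' : (M : ℝ) ≠ 0 := by positivity
  have hf : Function.Periodic f M := fun N => by
    simp only [f, hadd]
    push_cast
    field_simp
    ring
  obtain ⟨B, hB⟩ : ∃ B, ∀ N, |f N| ≤ B := by
    refine ⟨∑ i ∈ range M, |f i|, fun N => ?_⟩
    rw [← hf.map_mod_nat N]
    exact single_le_sum (f := fun i => |f i|) (fun i _ => abs_nonneg _)
      (mem_range.2 (Nat.mod_lt N hM))
  refine ⟨c / M, ?_⟩
  have h0 : Tendsto (fun N : ℕ => f N / N) atTop (𝓝 0) := by
    refine squeeze_zero_norm (fun N => ?_) (tendsto_const_div_atTop_nhds_zero_nat B)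
    rw [norm_div, Real.norm_eq_abs, Real.norm_natCast]
    gcongr
    exact hB N
  refine ((h0.add_const ((c : ℝ) / M)).congr' ?_).trans (by simp)
  filter_upwards [eventually_gt_atTop 0] with N hN
  have : (N : ℝ) ≠ 0 := by positivity
  simp only [f]
  field_simp
  ring

lemma OmegaLe_eq_length_filter (y : ℝ) (n : ℕ) :
    OmegaLe y n = (n.primeFactorsList.filter fun p : ℕ => decide ((p : ℝ) ≤ y)).length := by
  have h : (do let a ← n.primeFactorsList; pure (a : ℝ)) =
      n.primeFactorsList.map (fun a : ℕ => (a : ℝ)) :=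
    bind_pure_comp _ _
  rw [OmegaLe, h, List.filter_map, List.length_map]
  rfl

lemma OmegaLe_eq_sum_factorization (y : ℝ) (n : ℕ) :
    OmegaLe y n = ∑ p ∈ Nat.primesLE ⌊y⌋₊, n.factorization p := by
  have hmem {p : ℕ} (hp : p.Prime) : p ≤ ⌊y⌋₊ ↔ (p : ℝ) ≤ y := Nat.le_floor_iff' hp.ne_zero
  rw [OmegaLe_eq_length_filter, ← Multiset.coe_card, ← Multiset.sum_count_eq_card (s := Nat.primesLE ⌊y⌋₊)]
  · refine Finset.sum_congr rfl fun p hp => ?_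
    rw [Nat.mem_primesLE] at hp
    rw [Multiset.coe_count, List.count_filter (by simpa using (hmem hp.2).1 hp.1),
      Nat.primeFactorsList_count_eq]
  · intro p hp
    simp only [Multiset.mem_coe, List.mem_filter, decide_eq_true_eq] at hp
    have hpp := Nat.prime_of_mem_primeFactorsList hp.1
    exact Nat.mem_primesLE.2 ⟨(hmem hpp).2 hp.2, hpp⟩

lemma OmegaLe_le_of_dvd (y : ℝ) {d n : ℕ} (hn : n ≠ 0) (h : d ∣ n) :
    OmegaLe y d ≤ OmegaLe y n := by
  simp only [OmegaLe_eq_sum_factorization]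
  exact Finset.sum_le_sum fun p _ =>
    (Nat.factorization_le_iff_dvd (ne_zero_of_dvd_ne_zero hn h) hn).2 h p

lemma exists_dvd_of_le_OmegaLe {y : ℝ} {k n : ℕ} (hn : n ≠ 0) (h : k ≤ OmegaLe y n) :
    ∃ d, d ∣ n ∧ d ∣ ⌊y⌋₊.factorial ^ k ∧ k ≤ OmegaLe y d := by
  rw [OmegaLe_eq_length_filter] at h
  set l := (n.primeFactorsList.filter fun p : ℕ => decide ((p : ℝ) ≤ y)).take k with hl
  have hlen : l.length = k := by
    rw [hl, List.length_take]
    exact min_eq_left h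
  have hsub : l.Sublist n.primeFactorsList :=
    (List.take_sublist _ _).trans List.filter_sublist
  have hprime : ∀ p ∈ l, p.Prime := fun p hp =>
    Nat.prime_of_mem_primeFactorsList (hsub.subset hp)
  have hle : ∀ p ∈ l, (p : ℝ) ≤ y := fun p hp => by
    simpa using (List.mem_filter.1 ((List.take_sublist _ _).subset hp)).2
  refine ⟨l.prod, ?_, ?_, ?_⟩
  · have := hsub.prod_dvd_prod
    rwa [Nat.prod_primeFactorsList hn] at this
  · rw [← hlen]
    have key : ∀ l : List ℕ, (∀ p ∈ l, p ∣ ⌊y⌋₊.factorial) →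
        l.prod ∣ ⌊y⌋₊.factorial ^ l.length := by
      intro l
      induction l with
      | nil => simp
      | cons a l ih =>
        intro h
        rw [List.prod_cons, List.length_cons, pow_succ']
        exact mul_dvd_mul (h a (by simp)) (ih fun p hp => h p (by simp [hp]))
    exact key l fun p hp =>
      Nat.dvd_factorial (hprime p hp).pos ((Nat.le_floor_iff' (hprime p hp).ne_zero).2 (hle p hp))
  · have hperm := Nat.primeFactorsList_unique (n := l.prod) rfl hprime
    rw [OmegaLe_eq_length_filter, ← (hperm.filter _).length_eq, List.filter_eq_self.2 (by simpa using hle), hlen]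

lemma exists_hasDensity_le_OmegaLe (y : ℝ) (k : ℕ) :
    ∃ d, HasDensity {n : ℕ | 1 ≤ n ∧ k ≤ OmegaLe y n} d := by
  set M := ⌊y⌋₊.factorial ^ k
  have hM : 0 < M := by positivity
  have hper : Function.Periodic (fun n => ∃ d, d ∣ n ∧ d ∣ M ∧ k ≤ OmegaLe y d) M := by
    intro n
    refine propext (exists_congr fun d => ?_)
    constructor
    · rintro ⟨h1, h2, h3⟩
      exact ⟨(Nat.dvd_add_left h2).1 h1, h2, h3⟩
    · rintro ⟨h1, h2, h3⟩
      exact ⟨(Nat.dvd_add_left h2).2 h1, h2, h3⟩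
  obtain ⟨d, hd⟩ := exists_tendsto_card_filter_div_of_periodic hM hper
  refine ⟨d, hd.congr fun N => ?_⟩
  congr 3
  ext n
  simp only [Finset.mem_filter, Set.mem_ofPred_eq]
  refine and_congr_right fun hn => ?_
  have hn1 : 1 ≤ n := (Finset.mem_Icc.1 hn).1
  have hn0 : n ≠ 0 := by omega
  constructor
  · rintro ⟨e, h1, -, h3⟩
    exact ⟨hn1, h3.trans (OmegaLe_le_of_dvd y hn0 h1)⟩
  · rintro ⟨-, h⟩
    exact exists_dvd_of_le_OmegaLe hn0 h

/-- The sum of the reciprocals of the primes up to `N`. -/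
noncomputable def primeRecipSum (N : ℕ) : ℝ := ∑ p ∈ Nat.primesLE N, (p : ℝ)⁻¹

lemma primeRecipSum_le_aux {N : ℕ} (hN : 2 ≤ N) :
    primeRecipSum N ≤ Chebyshev.theta N / (N * Real.log N) + Real.log 4 *
      (Real.log (Real.log N) - (Real.log N)⁻¹ + ((Real.log 2)⁻¹ - Real.log (Real.log 2))) := by
  induction N, hN using Nat.le_induction with
  | base =>
    have h2 : Nat.primesLE 2 = {2} := by decide
    have : Real.log 2 ≠ 0 := by positivity
    simp only [primeRecipSum, Chebyshev.theta_eq_sum_primesLE_log, h2, Finset.sum_singleton]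
    push_cast
    field_simp
    simp
  | succ N hN ih =>
    have hN1 : (1 : ℝ) < N := by exact_mod_cast hN
    have hNpos : (0 : ℝ) < N := by linarith
    set a := Real.log N with ha
    set b := Real.log (N + 1 : ℝ) with hb
    have ha0 : 0 < a := Real.log_pos hN1
    have hab : a < b := Real.log_lt_log hNpos (by linarith)
    have hb0 : 0 < b := ha0.trans hab
    have hstep : primeRecipSum (N + 1) - Chebyshev.theta (N + 1 : ℕ) / ((N + 1) * b)
        = primeRecipSum N - Chebyshev.theta N / ((N + 1) * b) := by
      simp only [primeRecipSum, Chebyshev.theta_eq_sum_primesLE_log, Nat.primesLE_succ]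
      split_ifs
      · rw [Finset.sum_insert (Nat.notMem_primesLE N), Finset.sum_insert (Nat.notMem_primesLE N)]
        push_cast
        rw [← hb]
        field_simp
        ring
      · rfl
    have hdec : ((N + 1) * b)⁻¹ ≤ (N * a)⁻¹ := by
      gcongr
      linarith
    have htheta : Chebyshev.theta N * ((N * a)⁻¹ - ((N + 1) * b)⁻¹)
        ≤ Real.log 4 * N * ((N * a)⁻¹ - ((N + 1) * b)⁻¹) :=
      mul_le_mul_of_nonneg_right (Chebyshev.theta_le_log4_mul_x hNpos.le) (by linarith)
    have hlog : ((N + 1) * b)⁻¹ ≤ Real.log b - Real.log a := by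
      have h1 := Real.one_sub_inv_le_log_of_pos (div_pos hb0 ha0)
      have h2 := Real.one_sub_inv_le_log_of_pos (x := (N + 1 : ℝ) / N) (by positivity)
      rw [Real.log_div (by positivity) (by positivity)] at h1 h2
      rw [← ha, ← hb] at h2
      have h3 : 1 - ((N + 1 : ℝ) / N)⁻¹ = (N + 1 : ℝ)⁻¹ := by field_simp; ring
      have h4 : 1 - (b / a)⁻¹ = (b - a) * b⁻¹ := by field_simp
      rw [h3] at h2
      rw [h4] at h1
      refine le_trans ?_ h1
      rw [mul_inv]
      gcongr
    have hNa : N * ((N * a)⁻¹ - ((N + 1) * b)⁻¹) = a⁻¹ - b⁻¹ + ((N + 1) * b)⁻¹ := by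
      field_simp
      ring
    have hmain : Real.log 4 * N * ((N * a)⁻¹ - ((N + 1) * b)⁻¹)
        ≤ Real.log 4 * (a⁻¹ - b⁻¹ + (Real.log b - Real.log a)) := by
      rw [mul_assoc, hNa]
      gcongr
    push_cast at hstep ⊢
    rw [← hb]
    simp only [div_eq_mul_inv] at *
    linear_combination hstep + ih + htheta + hmain

/-- An upper bound in the direction of Mertens' second theorem, with Chebyshev's constant. -/
lemma exists_primeRecipSum_le : ∃ C : ℝ, ∀ N : ℕ, 2 ≤ N →
    primeRecipSum N ≤ Real.log 4 * Real.log (Real.log N) + C := by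
  refine ⟨Real.log 4 * ((Real.log 2)⁻¹ - Real.log (Real.log 2)), fun N hN => ?_⟩
  have hN1 : (1 : ℝ) < N := by exact_mod_cast hN
  have hlog := Real.log_pos hN1
  have h := primeRecipSum_le_aux hN
  have h2 : Chebyshev.theta N / (N * Real.log N) ≤ Real.log 4 * (Real.log N)⁻¹ := by
    rw [div_le_iff₀ (by positivity)]
    refine (Chebyshev.theta_le_log4_mul_x (by positivity)).trans (le_of_eq ?_)
    field_simp
  linear_combination h + h2

lemma sum_primesLE_inv_mul_sub_one_le (N : ℕ) :
    ∑ p ∈ Nat.primesLE N, ((p : ℝ) * (p - 1))⁻¹ ≤ 1 := by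
  rcases Nat.eq_zero_or_pos N with rfl | hN
  · simp
  have htel : ∑ p ∈ Finset.Ico 1 (N + 1), ((p : ℝ) * (p - 1))⁻¹ = 1 - (N : ℝ)⁻¹ := by
    induction N, hN using Nat.le_induction with
    | base => simp
    | succ N hN ih =>
      have : (0 : ℝ) < N := by exact_mod_cast hN
      rw [Finset.sum_Ico_succ_top (by omega), ih]
      push_cast
      rw [add_sub_cancel_right]
      field_simp
      ring
  have hsub : Nat.primesLE N ⊆ Finset.Ico 1 (N + 1) := fun p hp => by
    rw [Nat.mem_primesLE] at hp
    exact Finset.mem_Ico.2 ⟨hp.2.one_le, by omega⟩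
  refine (Finset.sum_le_sum_of_subset_of_nonneg hsub fun p hp _ => ?_).trans
    (htel.le.trans (by simp))
  have : (1 : ℝ) ≤ p := by exact_mod_cast (Finset.mem_Ico.1 hp).1
  have : (0 : ℝ) ≤ p - 1 := by linarith
  positivity

/-- A lower bound in the direction of Mertens' second theorem. -/
lemma log_log_le_primeRecipSum {y : ℝ} (hy : 1 < y) :
    Real.log (Real.log y) ≤ primeRecipSum ⌊y⌋₊ + 1 := by
  set N := ⌊y⌋₊
  let f : ℕ →* ℝ :=
    { toFun := fun n => (n : ℝ)⁻¹
      map_one' := by simp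
      map_mul' := fun m n => by push_cast; rw [mul_inv] }
  have hf {p : ℕ} (hp : p.Prime) : ‖f p‖ < 1 := by
    have : (1 : ℝ) < p := by exact_mod_cast hp.one_lt
    change ‖(p : ℝ)⁻¹‖ < 1
    rw [norm_inv, Real.norm_natCast]
    exact inv_lt_one_of_one_lt₀ this
  obtain ⟨-, hsum⟩ :=
    EulerProduct.summable_and_hasSum_smoothNumbers_prod_primesBelow_geometric hf (N + 1)
  have hsub : ∀ n ∈ Finset.Icc 1 N, n ∈ Nat.smoothNumbers (N + 1) := fun n hn => by
    rw [Finset.mem_Icc] at hn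
    exact Nat.mem_smoothNumbers_of_lt (by omega) (by omega)
  have hharm : ((harmonic N : ℚ) : ℝ) ≤ ∏ p ∈ Nat.primesLE N, (1 - (p : ℝ)⁻¹)⁻¹ := by
    have h1 := sum_le_hasSum ((Finset.Icc 1 N).subtype (· ∈ Nat.smoothNumbers (N + 1)))
      (fun n _ => (inv_nonneg.2 (Nat.cast_nonneg (n : ℕ)) : (0 : ℝ) ≤ f n)) hsum
    rw [harmonic_eq_sum_Icc]
    push_cast
    exact (Finset.sum_subtype_of_mem (fun n : ℕ => (n : ℝ)⁻¹) hsub).symm.le.trans h1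
  have hprod : ∏ p ∈ Nat.primesLE N, (1 - (p : ℝ)⁻¹)⁻¹ ≤ Real.exp (primeRecipSum N + 1) := by
    calc ∏ p ∈ Nat.primesLE N, (1 - (p : ℝ)⁻¹)⁻¹
        ≤ ∏ p ∈ Nat.primesLE N, Real.exp ((p : ℝ)⁻¹ + ((p : ℝ) * (p - 1))⁻¹) := by
          refine Finset.prod_le_prod (fun p hp => ?_) fun p hp => ?_
          · have : (1 : ℝ) < p := by exact_mod_cast Nat.one_lt_of_mem_primesLE hp
            have := inv_lt_one_of_one_lt₀ this
            exact inv_nonneg.2 (by linarith)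
          · have h1 : (1 : ℝ) < p := by exact_mod_cast Nat.one_lt_of_mem_primesLE hp
            have h2 : (0 : ℝ) < p - 1 := by linarith
            have h3 : (1 - (p : ℝ)⁻¹)⁻¹ = (p : ℝ)⁻¹ + ((p : ℝ) * (p - 1))⁻¹ + 1 := by
              have : (1 - (p : ℝ)⁻¹) = (p - 1) / p := by field_simp
              rw [this]
              field_simp
              ring
            rw [h3]
            exact Real.add_one_le_exp _
      _ = Real.exp (∑ p ∈ Nat.primesLE N, ((p : ℝ)⁻¹ + ((p : ℝ) * (p - 1))⁻¹)) :=
          (Real.exp_sum _ _).symm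
      _ ≤ Real.exp (primeRecipSum N + 1) := by
          rw [Finset.sum_add_distrib]
          exact Real.exp_le_exp.2 (add_le_add le_rfl (sum_primesLE_inv_mul_sub_one_le N))
  rw [Real.log_le_iff_le_exp (Real.log_pos hy)]
  exact ((log_le_harmonic_floor y (by linarith)).trans hharm).trans hprod

open Finset in
lemma tendsto_sum_dvd_div {d : ℕ} :
    Tendsto (fun N : ℕ => (∑ n ∈ Icc 1 N, if d ∣ n then (1 : ℝ) else 0) / N) atTop
      (𝓝 (d : ℝ)⁻¹) := by
  have h := (tendsto_nat_floor_mul_div_atTop (R := ℝ) (a := (d : ℝ)⁻¹) (by positivity)).comp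
    tendsto_natCast_atTop_atTop
  refine h.congr fun N => ?_
  have hcard : #{n ∈ Icc 1 N | d ∣ n} = N / d := by
    rw [← Nat.Ioc_filter_dvd_card_eq_div N d]
    rfl
  rw [sum_boole, hcard, Function.comp_apply, inv_mul_eq_div, Nat.floor_div_natCast,
    Nat.floor_natCast]

/-- The number of distinct primes up to `T` that divide `n`, as a real number. -/
noncomputable def omegaLe (T n : ℕ) : ℝ := ∑ p ∈ Nat.primesLE T, if p ∣ n then (1 : ℝ) else 0

lemma omegaLe_le_OmegaLe (y : ℝ) {n : ℕ} (hn : n ≠ 0) :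
    omegaLe ⌊y⌋₊ n ≤ OmegaLe y n := by
  rw [OmegaLe_eq_sum_factorization, omegaLe]
  push_cast
  refine Finset.sum_le_sum fun p hp => ?_
  split_ifs with h
  · exact_mod_cast (Nat.prime_of_mem_primesLE hp).factorization_pos_of_dvd hn h
  · positivity

lemma tendsto_sum_omegaLe_div (T : ℕ) :
    Tendsto (fun N : ℕ => (∑ n ∈ Finset.Icc 1 N, omegaLe T n) / N) atTop
      (𝓝 (primeRecipSum T)) := by
  refine (tendsto_finsetSum (Nat.primesLE T) fun p _ => tendsto_sum_dvd_div (d := p)).congr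
    fun N => ?_
  simp only [omegaLe]
  rw [Finset.sum_comm, Finset.sum_div]

lemma tendsto_sum_sq_omegaLe_div (T : ℕ) :
    Tendsto (fun N : ℕ => (∑ n ∈ Finset.Icc 1 N, omegaLe T n ^ 2) / N) atTop
      (𝓝 (∑ p ∈ Nat.primesLE T, ∑ q ∈ Nat.primesLE T, ((Nat.lcm p q : ℕ) : ℝ)⁻¹)) := by
  refine (tendsto_finsetSum (Nat.primesLE T) fun p _ => tendsto_finsetSum (Nat.primesLE T)
    fun q _ => tendsto_sum_dvd_div (d := Nat.lcm p q)).congr fun N => ?_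
  have h (n : ℕ) : omegaLe T n ^ 2 = ∑ p ∈ Nat.primesLE T, ∑ q ∈ Nat.primesLE T,
      if Nat.lcm p q ∣ n then (1 : ℝ) else 0 := by
    rw [omegaLe, sq, Finset.sum_mul_sum]
    refine Finset.sum_congr rfl fun p _ => Finset.sum_congr rfl fun q _ => ?_
    simp only [Nat.lcm_dvd_iff, ite_and]
    split_ifs <;> simp
  simp only [h, ← Finset.sum_div]
  congr 1
  refine Eq.trans ?_ Finset.sum_comm
  exact Finset.sum_congr rfl fun p _ => Finset.sum_comm

/-- The variance bound of Turán for the number of prime divisors up to `T`. -/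
lemma exists_tendsto_variance_omegaLe (T : ℕ) :
    ∃ V ≤ primeRecipSum T, Tendsto
      (fun N : ℕ => (∑ n ∈ Finset.Icc 1 N, (omegaLe T n - primeRecipSum T) ^ 2) / N) atTop
      (𝓝 V) := by
  set S := primeRecipSum T with hS
  have hlim := ((tendsto_sum_sq_omegaLe_div T).sub
    ((tendsto_sum_omegaLe_div T).const_mul (2 * S))).add_const (S ^ 2)
  refine ⟨_, ?_, hlim.congr' ?_⟩
  · have hpair : ∑ p ∈ Nat.primesLE T, ∑ q ∈ Nat.primesLE T, ((Nat.lcm p q : ℕ) : ℝ)⁻¹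
        ≤ ∑ p ∈ Nat.primesLE T, ∑ q ∈ Nat.primesLE T,
          ((p : ℝ)⁻¹ * (q : ℝ)⁻¹ + if p = q then (p : ℝ)⁻¹ else 0) := by
      refine Finset.sum_le_sum fun p hp => Finset.sum_le_sum fun q hq => ?_
      split_ifs with h
      · subst h
        rw [Nat.lcm_self]
        have : (0 : ℝ) ≤ (p : ℝ)⁻¹ * (p : ℝ)⁻¹ := by positivity
        linarith
      · have hco : Nat.Coprime p q := (Nat.coprime_primes (Nat.prime_of_mem_primesLE hp)
          (Nat.prime_of_mem_primesLE hq)).2 h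
        rw [hco.lcm_eq_mul]
        push_cast
        rw [mul_inv, add_zero]
    have hsum : ∑ p ∈ Nat.primesLE T, ∑ q ∈ Nat.primesLE T,
          ((p : ℝ)⁻¹ * (q : ℝ)⁻¹ + if p = q then (p : ℝ)⁻¹ else 0) = S ^ 2 + S := by
      simp only [Finset.sum_add_distrib]
      rw [← Finset.sum_mul_sum, ← sq]
      congr 1
      exact Finset.sum_congr rfl fun p hp => by rw [Finset.sum_ite_eq, if_pos hp]
    rw [← hS]
    linarith
  · filter_upwards [eventually_gt_atTop 0] with N hN
    have : (N : ℝ) ≠ 0 := by positivity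
    have h (n : ℕ) : (omegaLe T n - S) ^ 2 = omegaLe T n ^ 2 - 2 * S * omegaLe T n + S ^ 2 := by
      ring
    simp only [h, Finset.sum_add_distrib, Finset.sum_sub_distrib, ← Finset.mul_sum,
      Finset.sum_const, Nat.card_Icc, Nat.add_sub_cancel, nsmul_eq_mul]
    field_simp

lemma sum_factorization_le {p : ℕ} (hp : p.Prime) (N : ℕ) :
    ∑ n ∈ Finset.Icc 1 N, (n.factorization p : ℝ) ≤ N * ((p : ℝ) - 1)⁻¹ := by
  have h1 : ∑ n ∈ Finset.Ico 1 (N + 1), n.factorization p = N.factorial.factorization p := by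
    rw [← Finset.prod_Ico_id_eq_factorial, Nat.factorization_prod, Finsupp.finsetSum_apply]
    intro n hn
    have := (Finset.mem_Ico.1 hn).1
    omega
  have h2 : ((N.factorial.factorization p : ℕ) : ℝ) ≤ N / ((p - 1 : ℕ) : ℝ) :=
    (Nat.cast_le.2 (Nat.factorization_factorial_le_div_pred hp N)).trans Nat.cast_div_le
  rw [Nat.cast_sub hp.one_le, Nat.cast_one, ← h1] at h2
  push_cast at h2
  rwa [← div_eq_mul_inv]

/-- The mean of `Ω - ω`, restricted to primes up to `y`, is bounded by a convergent sequence with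
limit at most `1`. -/
lemma exists_tendsto_sum_OmegaLe_sub_omegaLe_div_le (y : ℝ) :
    ∃ (g : ℕ → ℝ) (E : ℝ), E ≤ 1 ∧ Tendsto g atTop (𝓝 E) ∧ ∀ N : ℕ, 0 < N →
      (∑ n ∈ Finset.Icc 1 N, ((OmegaLe y n : ℝ) - omegaLe ⌊y⌋₊ n)) / N ≤ g N := by
  refine ⟨_, _, ?_, (tendsto_sum_omegaLe_div ⌊y⌋₊).const_sub
    (∑ p ∈ Nat.primesLE ⌊y⌋₊, ((p : ℝ) - 1)⁻¹), fun N hN => ?_⟩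
  · refine le_trans (le_of_eq ?_) (sum_primesLE_inv_mul_sub_one_le ⌊y⌋₊)
    rw [primeRecipSum, ← Finset.sum_sub_distrib]
    refine Finset.sum_congr rfl fun p hp => ?_
    have h1 : (1 : ℝ) < p := by exact_mod_cast Nat.one_lt_of_mem_primesLE hp
    have h2 : (p : ℝ) - 1 ≠ 0 := by linarith
    field_simp
    ring
  · have hN' : (0 : ℝ) < N := by exact_mod_cast hN
    rw [Finset.sum_sub_distrib, sub_div]
    refine sub_le_sub_right ?_ _
    rw [div_le_iff₀ hN']
    simp only [OmegaLe_eq_sum_factorization]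
    push_cast
    rw [Finset.sum_comm, Finset.sum_mul]
    refine Finset.sum_le_sum fun p hp => ?_
    rw [mul_comm]
    exact sum_factorization_le (Nat.prime_of_mem_primesLE hp) N

lemma density_le_of_mean_lt {y a b d : ℝ} {K : ℕ}
    (hd : HasDensity {n : ℕ | 1 ≤ n ∧ K ≤ OmegaLe y n} d) (ha : 0 < a) (hb : 0 < b)
    (h : primeRecipSum ⌊y⌋₊ + a + b ≤ K) :
    d ≤ primeRecipSum ⌊y⌋₊ / a ^ 2 + 1 / b := by
  set S := primeRecipSum ⌊y⌋₊
  obtain ⟨V, hV, hVlim⟩ := exists_tendsto_variance_omegaLe ⌊y⌋₊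
  obtain ⟨g, E, hE, hglim, hg⟩ := exists_tendsto_sum_OmegaLe_sub_omegaLe_div_le y
  have hle : d ≤ V / a ^ 2 + E / b := by
    refine le_of_tendsto_of_tendsto hd ((hVlim.div_const (a ^ 2)).add (hglim.div_const b)) ?_
    filter_upwards [eventually_gt_atTop 0] with N hN
    have hN' : (0 : ℝ) < N := by exact_mod_cast hN
    refine le_trans ?_ (add_le_add_right (div_le_div_of_nonneg_right (hg N hN) hb.le) _)
    rw [div_right_comm, div_right_comm _ _ b, ← add_div]
    refine div_le_div_of_nonneg_right ?_ hN'.le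
    rw [← Finset.sum_boole, Finset.sum_div, Finset.sum_div, ← Finset.sum_add_distrib]
    refine Finset.sum_le_sum fun n hn => ?_
    have hn0 : n ≠ 0 := by
      have := (Finset.mem_Icc.1 hn).1
      omega
    have hw := sub_nonneg.2 (omegaLe_le_OmegaLe y hn0)
    split_ifs with hmem
    · have hK : (K : ℝ) ≤ OmegaLe y n := by exact_mod_cast hmem.2
      by_cases hcase : a ≤ omegaLe ⌊y⌋₊ n - S
      · have h1 : 1 ≤ (omegaLe ⌊y⌋₊ n - S) ^ 2 / a ^ 2 := by
          rw [one_le_div (by positivity)]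
          gcongr
        have h2 := div_nonneg hw hb.le
        linarith
      · have h1 : 1 ≤ ((OmegaLe y n : ℝ) - omegaLe ⌊y⌋₊ n) / b := by
          rw [one_le_div hb]
          linarith
        have h2 : 0 ≤ (omegaLe ⌊y⌋₊ n - S) ^ 2 / a ^ 2 := by positivity
        linarith
    · positivity
  refine hle.trans ?_
  gcongr

lemma le_density_of_lt_mean {y a d : ℝ} {K : ℕ}
    (hd : HasDensity {n : ℕ | 1 ≤ n ∧ K ≤ OmegaLe y n} d) (ha : 0 < a)
    (h : K + a ≤ primeRecipSum ⌊y⌋₊) :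
    1 - primeRecipSum ⌊y⌋₊ / a ^ 2 ≤ d := by
  set S := primeRecipSum ⌊y⌋₊
  obtain ⟨V, hV, hVlim⟩ := exists_tendsto_variance_omegaLe ⌊y⌋₊
  have hle : 1 - V / a ^ 2 ≤ d := by
    refine le_of_tendsto_of_tendsto ((hVlim.div_const (a ^ 2)).const_sub 1) hd ?_
    filter_upwards [eventually_gt_atTop 0] with N hN
    have hN' : (0 : ℝ) < N := by exact_mod_cast hN
    rw [div_right_comm, sub_le_iff_le_add, ← add_div, one_le_div hN', ← Finset.sum_boole,
      Finset.sum_div, ← Finset.sum_add_distrib]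
    have hcount : (N : ℝ) = ∑ n ∈ Finset.Icc 1 N, (1 : ℝ) := by simp
    rw [hcount]
    refine Finset.sum_le_sum fun n hn => ?_
    have hn1 := (Finset.mem_Icc.1 hn).1
    have hsq : 0 ≤ (omegaLe ⌊y⌋₊ n - S) ^ 2 / a ^ 2 := by positivity
    split_ifs with hmem
    · linarith
    · have hK : (OmegaLe y n : ℝ) ≤ K := by
        exact_mod_cast (not_le.1 fun hK => hmem ⟨hn1, hK⟩).le
      have hw := omegaLe_le_OmegaLe y (n := n) (by omega)
      rw [zero_add, one_le_div (by positivity), ← neg_sub, neg_sq]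
      gcongr
      linarith
  refine le_trans ?_ hle
  gcongr

lemma density_mem_Icc {A : Set ℕ} {d : ℝ} (hd : HasDensity A d) : d ∈ Set.Icc 0 1 := by
  refine isClosed_Icc.mem_of_tendsto hd (Eventually.of_forall fun N => ⟨by positivity, ?_⟩)
  refine div_le_one_of_le₀ ?_ (by positivity)
  exact_mod_cast (Finset.card_filter_le _ _).trans (by simp)

/-- The sum of reciprocals of primes up to `yk k` lies well between `k` and `2 * k`. -/
lemma eventually_primeRecipSum_yk_mem :
    ∀ᶠ k : ℕ in atTop,
      primeRecipSum ⌊yk k⌋₊ ∈ Set.Icc (1.1 * k : ℝ) (1.9 * k) := by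
  obtain ⟨C, hC⟩ := exists_primeRecipSum_le
  filter_upwards [tendsto_natCast_atTop_atTop.eventually_ge_atTop (max 10 (20 * C))] with k hk
  have hk10 : (10 : ℝ) ≤ k := (le_max_left _ _).trans hk
  have hkC : 20 * C ≤ k := (le_max_right _ _).trans hk
  have hloglog : Real.log (Real.log (yk k)) = 4 * k / 3 := by
    rw [yk, Real.log_exp, Real.log_exp]
  have hexp : 1 < Real.exp (4 * k / 3 : ℝ) := Real.one_lt_exp_iff.2 (by linarith)
  have hy2 : 2 ≤ yk k := by
    have := Real.add_one_le_exp (Real.exp (4 * k / 3 : ℝ))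
    rw [yk]
    linarith
  have hN : 2 ≤ ⌊yk k⌋₊ := Nat.le_floor (by exact_mod_cast hy2)
  constructor
  · have := log_log_le_primeRecipSum (y := yk k) (by linarith)
    linarith
  · have hN1 : (1 : ℝ) < ⌊yk k⌋₊ := by exact_mod_cast hN
    have hmono : Real.log (Real.log ⌊yk k⌋₊) ≤ 4 * k / 3 := by
      rw [← hloglog]
      refine Real.log_le_log (Real.log_pos hN1) (Real.log_le_log (by linarith) ?_)
      exact Nat.floor_le (by linarith)
    have hlog4 : Real.log 4 ≤ 1.387 := by
      rw [show (4 : ℝ) = 2 ^ 2 by norm_num, Real.log_pow]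
      have := Real.log_two_lt_d9
      push_cast
      linarith
    have hlog0 : 0 ≤ Real.log 4 := Real.log_nonneg (by norm_num)
    have h1 := hC _ hN
    have h2 : Real.log 4 * Real.log (Real.log ⌊yk k⌋₊) ≤ 1.387 * (4 * k / 3) := by
      refine (mul_le_mul_of_nonneg_left hmono hlog0).trans ?_
      gcongr
    linarith

theorem densities_of_many_small_factors_sets :
    ∃ δ δ' : ℕ → ℝ,
      (∀ k : ℕ, 0 < k →
        HasDensity {n : ℕ | 1 ≤ n ∧ k ≤ OmegaLe (yk k) n} (δ k)) ∧
      (∀ k : ℕ, 0 < k →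
        HasDensity {n : ℕ | 1 ≤ n ∧ 2 * k ≤ OmegaLe (yk k) n} (δ' k)) ∧
      Filter.Tendsto δ Filter.atTop (nhds 1) ∧
      Filter.Tendsto δ' Filter.atTop (nhds 0) := by
  choose δ hδ using fun k : ℕ => exists_hasDensity_le_OmegaLe (yk k) k
  choose δ' hδ' using fun k : ℕ => exists_hasDensity_le_OmegaLe (yk k) (2 * k)
  refine ⟨δ, δ', fun k _ => hδ k, fun k _ => hδ' k, ?_, ?_⟩
  · refine tendsto_of_tendsto_of_tendsto_of_le_of_le'
      (by simpa using (tendsto_const_div_atTop_nhds_zero_nat 190).const_sub (1 : ℝ))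
      tendsto_const_nhds ?_ (Eventually.of_forall fun k => (density_mem_Icc (hδ k)).2)
    filter_upwards [eventually_primeRecipSum_yk_mem, eventually_gt_atTop 0] with k hS hk
    have hk' : (0 : ℝ) < k := by exact_mod_cast hk
    have h := le_density_of_lt_mean (hδ k) (a := 0.1 * k) (by positivity) (by linarith [hS.1])
    refine le_trans ?_ h
    have : primeRecipSum ⌊yk k⌋₊ / (0.1 * k) ^ 2 ≤ 1.9 * k / (0.1 * k) ^ 2 := by
      gcongr
      exact hS.2
    have h2 : 1.9 * k / (0.1 * k) ^ 2 = (190 : ℝ) / k := by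
      field_simp
      norm_num
    linarith
  · refine tendsto_of_tendsto_of_tendsto_of_le_of_le' tendsto_const_nhds
      (tendsto_const_div_atTop_nhds_zero_nat (780 : ℝ))
      (Eventually.of_forall fun k => (density_mem_Icc (hδ' k)).1) ?_
    filter_upwards [eventually_primeRecipSum_yk_mem, eventually_gt_atTop 0] with k hS hk
    have hk' : (0 : ℝ) < k := by exact_mod_cast hk
    have h := density_le_of_mean_lt (hδ' k) (a := 0.05 * k) (b := 0.05 * k) (by positivity)
      (by positivity) (by push_cast; linarith [hS.2])
    refine h.trans ?_
    have : primeRecipSum ⌊yk k⌋₊ / (0.05 * k) ^ 2 ≤ 1.9 * k / (0.05 * k) ^ 2 := by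
      gcongr
      exact hS.2
    have h2 : 1.9 * k / (0.05 * k) ^ 2 + 1 / (0.05 * k) = (780 : ℝ) / k := by
      field_simp
      norm_num
    linarith
end
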